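/- For every μ ∈ 𝓜, every 0 ≤ s < t ≤ 1 and every x ∈ ℝ, Φ_μ(s,x) = max{ F^{s,t}(u,x) : u ∈ 𝓓[s,t] }; in particular the supremum of F^{s,t}(·,x) over 𝓓[s,t] is attained and equals Φ_μ(s,x). -/

import Mathlib

open MeasureTheory ProbabilityTheory Real Set Filter

noncomputable section

/-- `ξ(s) = ∑_{p≥2} β_p² s^p` (we use `β : ℕ → ℝ` with `β 0 = β 1 = 0`). -/
def xiFn (β : ℕ → ℝ) (s : ℝ) : ℝ := ∑' p : ℕ, β p ^ 2 * s ^ p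

/-- `ξ'(s)`. -/
def xiD (β : ℕ → ℝ) (s : ℝ) : ℝ := ∑' p : ℕ, (p : ℝ) * β p ^ 2 * s ^ (p - 1)

/-- `ζ(s) = ξ''(s)`. -/
def zetaFn (β : ℕ → ℝ) (s : ℝ) : ℝ :=
  ∑' p : ℕ, (p : ℝ) * ((p : ℝ) - 1) * β p ^ 2 * s ^ (p - 2)

/-- admissible sequence of temperature parameters -/
def ValidBeta (β : ℕ → ℝ) : Prop :=
  β 0 = 0 ∧ β 1 = 0 ∧ (∀ p, 0 ≤ β p) ∧ (∃ p, 2 ≤ p ∧ 0 < β p) ∧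
    Summable fun p : ℕ => (2 : ℝ) ^ p * β p ^ 2

/-- membership in `𝓜`: a Borel probability measure concentrated on `[0,1]` -/
def MemM (μ : Measure ℝ) : Prop := IsProbabilityMeasure μ ∧ μ (Icc (0 : ℝ) 1)ᶜ = 0

/-- member of `𝓜_d`: finitely supported -/
def FinSupp (μ : Measure ℝ) : Prop := ∃ S : Finset ℝ, μ ((S : Set ℝ))ᶜ = 0

/-- the distribution function `α(s) = μ([0,s])` -/
def distF (μ : Measure ℝ) (s : ℝ) : ℝ := (μ (Icc 0 s)).toReal

/-- the metric `d(μ,ν) = ∫_0^1 |μ([0,s]) - ν([0,s])| ds` -/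
def dM (μ ν : Measure ℝ) : ℝ := ∫ s in (0 : ℝ)..1, |distF μ s - distF ν s|

/-- the smallest atom of `μ` strictly after `s` (or `1` if there is none) -/
def nextPt (μ : Measure ℝ) (s : ℝ) : ℝ :=
  sInf ({q : ℝ | s < q ∧ q ≤ 1 ∧ μ {q} ≠ 0} ∪ {1})

/-- one step of the backward recursion defining the Parisi PDE solution:
`(1/m) log E exp (m Φ(t, x + z √(ξ'(t) - ξ'(s))))`, interpreted as
`E Φ(t, x + z √(ξ'(t) - ξ'(s)))` when `m = 0`. -/
def gStep (β : ℕ → ℝ) (Φ : ℝ → ℝ → ℝ) (m t s x : ℝ) : ℝ :=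
  if m = 0 then ∫ z, Φ t (x + z * Real.sqrt (xiD β t - xiD β s)) ∂(gaussianReal 0 1)
  else m⁻¹ * Real.log
    (∫ z, Real.exp (m * Φ t (x + z * Real.sqrt (xiD β t - xiD β s))) ∂(gaussianReal 0 1))

/-- `Φ` is the Parisi PDE solution of a finitely supported `μ`. -/
def IsAtomicSol (β : ℕ → ℝ) (μ : Measure ℝ) (Φ : ℝ → ℝ → ℝ) : Prop :=
  (∀ x : ℝ, Φ 1 x = Real.log (Real.cosh x)) ∧
  (∀ s ∈ Ico (0 : ℝ) 1, ∀ x : ℝ, Φ s x = gStep β Φ (distF μ s) (nextPt μ s) s x)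

/-- `Φ` is the Parisi family `μ ↦ Φ_μ`: it satisfies the backward recursion on `𝓜_d`
and is `d`-continuous on `𝓜` (uniformly in `(s,x) ∈ [0,1] × ℝ`). -/
def IsParisiFamily (β : ℕ → ℝ) (Φ : Measure ℝ → ℝ → ℝ → ℝ) : Prop :=
  (∀ μ, MemM μ → FinSupp μ → IsAtomicSol β μ (Φ μ)) ∧
  (∀ μ, MemM μ → ∀ ε : ℝ, 0 < ε → ∃ δ : ℝ, 0 < δ ∧ ∀ ν, MemM ν → dM μ ν < δ →
      ∀ s ∈ Icc (0 : ℝ) 1, ∀ x : ℝ, |Φ μ s x - Φ ν s x| < ε)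

/-- `B` is a standard Brownian motion under `P`. -/
def IsStdBM {Ω : Type*} [MeasurableSpace Ω] (P : Measure Ω) (B : ℝ → Ω → ℝ) : Prop :=
  (∀ t : ℝ, Measurable (B t)) ∧
  (∀ᵐ ω ∂P, B 0 ω = 0) ∧
  (∀ᵐ ω ∂P, Continuous fun t => B t ω) ∧
  (∀ s t : ℝ, 0 ≤ s → s ≤ t →
    Measure.map (fun ω => B t ω - B s ω) P = gaussianReal 0 (Real.toNNReal (t - s))) ∧
  (∀ s t : ℝ, 0 ≤ s → s ≤ t →
    Indep (MeasurableSpace.comap (fun ω => B t ω - B s ω) inferInstance)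
      (⨆ v ∈ Icc (0 : ℝ) s, MeasurableSpace.comap (B v) inferInstance) P)

/-- the space `𝓓[s,t]`: progressively measurable processes bounded by `1` on `[s,t]` -/
def InD {Ω : Type*} {mΩ : MeasurableSpace Ω} (𝓕 : Filtration ℝ mΩ) (s t : ℝ)
    (u : ℝ → Ω → ℝ) : Prop :=
  ProgMeasurable 𝓕 u ∧ ∀ r ∈ Icc s t, ∀ ω, |u r ω| ≤ 1

/-- the norm `‖u‖ = (E ∫_s^t u(r)² dr)^{1/2}` on `𝓓[s,t]` -/
def normD {Ω : Type*} [MeasurableSpace Ω] (P : Measure Ω) (s t : ℝ)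
    (u : ℝ → Ω → ℝ) : ℝ :=
  Real.sqrt (∫ ω, (∫ r in s..t, (u r ω) ^ 2) ∂P)

/-- the functional
`F^{s,t}(u,x) = E[Φ_μ(t, x + ∫_s^t α ζ u dr + W(t) - W(s)) - (1/2)∫_s^t α ζ u² dr]`,
where `W r = B (ξ' r)`. -/
def Ffn {Ω : Type*} [MeasurableSpace Ω] (P : Measure Ω) (β : ℕ → ℝ) (μ : Measure ℝ)
    (Φ : ℝ → ℝ → ℝ) (W : ℝ → Ω → ℝ) (s t : ℝ) (u : ℝ → Ω → ℝ) (x : ℝ) : ℝ :=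
  ∫ ω, (Φ t (x + (∫ r in s..t, distF μ r * zetaFn β r * u r ω) + (W t ω - W s ω))
      - (1 / 2) * ∫ r in s..t, distF μ r * zetaFn β r * (u r ω) ^ 2) ∂P


section

lemma aux_sq_le_two_pow (p : ℕ) : (p : ℝ) * (p : ℝ) ≤ 4 * 2 ^ p := by
  have h : ∀ p : ℕ, p * p ≤ 4 * 2 ^ p := by
    intro p
    induction p with
    | zero => simp
    | succ k ih =>
      by_cases hk : k ≤ 2
      · interval_cases k <;> norm_num
      · push Not at hk
        rw [pow_succ]
        nlinarith
  exact_mod_cast h p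

lemma summ_bound {β : ℕ → ℝ} (hβ : ValidBeta β) :
    Summable fun p : ℕ => (p : ℝ) * (p : ℝ) * β p ^ 2 := by
  refine Summable.of_nonneg_of_le (fun p => by positivity) (fun p => ?_) (hβ.2.2.2.2.mul_left 4)
  have := aux_sq_le_two_pow p
  have h2 := sq_nonneg (β p)
  nlinarith

lemma coef_nonneg (p : ℕ) : 0 ≤ (p : ℝ) * ((p : ℝ) - 1) := by
  rcases Nat.eq_zero_or_pos p with h | h
  · simp [h]
  · have : (1 : ℝ) ≤ p := by exact_mod_cast h
    nlinarith

lemma zeta_term_bound (β : ℕ → ℝ) (p : ℕ) {r : ℝ} (hr : r ∈ Icc (0:ℝ) 1) :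
    ‖(p : ℝ) * ((p : ℝ) - 1) * β p ^ 2 * r ^ (p - 2)‖ ≤ (p : ℝ) * (p : ℝ) * β p ^ 2 := by
  have h1 := coef_nonneg p
  have h2 : r ^ (p - 2) ≤ 1 := pow_le_one₀ hr.1 hr.2
  have h3 : 0 ≤ r ^ (p - 2) := pow_nonneg hr.1 _
  have h4 := sq_nonneg (β p)
  rw [Real.norm_of_nonneg (by positivity)]
  have h5 : (p : ℝ) * ((p : ℝ) - 1) * β p ^ 2 * r ^ (p - 2) ≤ (p : ℝ) * ((p : ℝ) - 1) * β p ^ 2 :=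
    mul_le_of_le_one_right (by positivity) h2
  have h6 : (0:ℝ) ≤ p := by positivity
  nlinarith

lemma zeta_cont {β : ℕ → ℝ} (hβ : ValidBeta β) : ContinuousOn (zetaFn β) (Icc 0 1) := by
  unfold zetaFn
  refine continuousOn_tsum (u := fun p : ℕ => (p : ℝ) * (p : ℝ) * β p ^ 2) (fun p => by fun_prop)
    (summ_bound hβ) (fun p r hr => zeta_term_bound β p hr)

lemma zeta_nonneg (β : ℕ → ℝ) {r : ℝ} (hr : 0 ≤ r) : 0 ≤ zetaFn β r := by
  refine tsum_nonneg fun p => ?_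
  have h1 := coef_nonneg p
  positivity

lemma xiD_nonneg (β : ℕ → ℝ) {r : ℝ} (hr : 0 ≤ r) : 0 ≤ xiD β r :=
  tsum_nonneg fun p => by positivity

lemma xiD_summable {β : ℕ → ℝ} (hβ : ValidBeta β) {r : ℝ} (hr : r ∈ Icc (0:ℝ) 1) :
    Summable fun p : ℕ => (p : ℝ) * β p ^ 2 * r ^ (p - 1) := by
  refine Summable.of_nonneg_of_le (fun p => ?_) (fun p => ?_) (summ_bound hβ)
  · have := hr.1
    positivity
  · have h2 : r ^ (p - 1) ≤ 1 := pow_le_one₀ hr.1 hr.2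
    have h5 : (p : ℝ) * β p ^ 2 * r ^ (p - 1) ≤ (p : ℝ) * β p ^ 2 :=
      mul_le_of_le_one_right (by positivity) h2
    have h6 : (p : ℝ) * β p ^ 2 ≤ (p : ℝ) * (p : ℝ) * β p ^ 2 := by
      rcases Nat.eq_zero_or_pos p with h | h
      · simp [h]
      · have : (1 : ℝ) ≤ p := by exact_mod_cast h
        have h7 : 0 ≤ (p : ℝ) * β p ^ 2 := by positivity
        nlinarith
    exact h5.trans h6

lemma zeta_intervalIntegrable {β : ℕ → ℝ} (hβ : ValidBeta β) {a b : ℝ} (ha : a ∈ Icc (0:ℝ) 1)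
    (hb : b ∈ Icc (0:ℝ) 1) : IntervalIntegrable (zetaFn β) volume a b :=
  ((zeta_cont hβ).mono (fun _ hr => (convex_Icc (0:ℝ) 1).ordConnected.uIcc_subset ha hb hr)).intervalIntegrable

lemma integral_zeta {β : ℕ → ℝ} (hβ : ValidBeta β) {a b : ℝ} (ha : 0 ≤ a) (hab : a ≤ b)
    (hb : b ≤ 1) : ∫ r in a..b, zetaFn β r = xiD β b - xiD β a := by
  have haI : a ∈ Icc (0:ℝ) 1 := ⟨ha, hab.trans hb⟩
  have hbI : b ∈ Icc (0:ℝ) 1 := ⟨ha.trans hab, hb⟩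
  have key : HasSum (fun p : ℕ => ∫ r in a..b, (p : ℝ) * ((p : ℝ) - 1) * β p ^ 2 * r ^ (p - 2))
      (∫ r in a..b, zetaFn β r) := by
    refine intervalIntegral.hasSum_integral_of_dominated_convergence
      (bound := fun (p : ℕ) _ => (p : ℝ) * (p : ℝ) * β p ^ 2) (fun p => ?_) (fun p => ?_) ?_ ?_ ?_
    · exact (by fun_prop : Continuous fun r : ℝ => (p : ℝ) * ((p : ℝ) - 1) * β p ^ 2 * r ^ (p - 2)).aestronglyMeasurable
    · refine Eventually.of_forall fun r hr => ?_
      rw [uIoc_of_le hab] at hr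
      exact zeta_term_bound β p ⟨ha.trans hr.1.le, hr.2.trans hb⟩
    · exact Eventually.of_forall fun r hr => summ_bound hβ
    · exact intervalIntegrable_const
    · refine Eventually.of_forall fun r hr => ?_
      rw [uIoc_of_le hab] at hr
      refine Summable.hasSum ?_
      exact Summable.of_norm_bounded (summ_bound hβ) fun p =>
        zeta_term_bound β p ⟨ha.trans hr.1.le, hr.2.trans hb⟩
  have key2 := (xiD_summable hβ hbI).hasSum.sub (xiD_summable hβ haI).hasSum
  have hd : ∀ p : ℕ, ∀ r : ℝ, HasDerivAt (fun r : ℝ => (p : ℝ) * β p ^ 2 * r ^ (p - 1))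
      ((p : ℝ) * ((p : ℝ) - 1) * β p ^ 2 * r ^ (p - 2)) r := by
    intro p r
    have h := (hasDerivAt_pow (p - 1) r).const_mul ((p : ℝ) * β p ^ 2)
    have he : (p : ℝ) * ((p : ℝ) - 1) * β p ^ 2 * r ^ (p - 2)
        = (p : ℝ) * β p ^ 2 * (((p - 1 : ℕ) : ℝ) * r ^ (p - 1 - 1)) := by
      rcases p with _ | p
      · simp
      · simp only [Nat.add_sub_cancel, Nat.cast_add, Nat.cast_one]
        have : p + 1 - 2 = p - 1 := by omega
        rw [this]
        ring
    rw [he]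
    exact h
  have hterm : (fun p : ℕ => ∫ r in a..b, (p : ℝ) * ((p : ℝ) - 1) * β p ^ 2 * r ^ (p - 2))
      = fun p : ℕ => (p : ℝ) * β p ^ 2 * b ^ (p - 1) - (p : ℝ) * β p ^ 2 * a ^ (p - 1) := by
    funext p
    rw [intervalIntegral.integral_eq_sub_of_hasDerivAt (fun r _ => hd p r)]
    exact (by fun_prop : Continuous fun r : ℝ =>
      (p : ℝ) * ((p : ℝ) - 1) * β p ^ 2 * r ^ (p - 2)).intervalIntegrable _ _
  rw [hterm] at key
  exact key.unique key2

lemma zeta_bdd {β : ℕ → ℝ} (hβ : ValidBeta β) :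
    ∃ L : ℝ, 1 ≤ L ∧ ∀ r ∈ Icc (0:ℝ) 1, zetaFn β r ≤ L := by
  obtain ⟨L, hL⟩ := (isCompact_Icc.image_of_continuousOn (zeta_cont hβ)).bddAbove
  exact ⟨max L 1, le_max_right _ _, fun r hr => le_max_of_le_left (hL ⟨r, hr, rfl⟩)⟩

lemma xiD_mono {β : ℕ → ℝ} (hβ : ValidBeta β) {a b : ℝ} (ha : 0 ≤ a) (hab : a ≤ b)
    (hb : b ≤ 1) : xiD β a ≤ xiD β b := by
  have h := integral_zeta hβ ha hab hb
  have h2 : 0 ≤ ∫ r in a..b, zetaFn β r :=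
    intervalIntegral.integral_nonneg hab fun r hr => zeta_nonneg β (ha.trans hr.1)
  linarith

lemma xiD_lip {β : ℕ → ℝ} (hβ : ValidBeta β) {L : ℝ} (hL : ∀ r ∈ Icc (0:ℝ) 1, zetaFn β r ≤ L)
    {a b : ℝ} (ha : 0 ≤ a) (hab : a ≤ b) (hb : b ≤ 1) :
    xiD β b - xiD β a ≤ L * (b - a) := by
  rw [← integral_zeta hβ ha hab hb]
  have : ∫ r in a..b, zetaFn β r ≤ ∫ r in a..b, L :=
    intervalIntegral.integral_mono_on hab
      (zeta_intervalIntegrable hβ ⟨ha, hab.trans hb⟩ ⟨ha.trans hab, hb⟩)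
      intervalIntegrable_const (fun r hr => hL r ⟨ha.trans hr.1, hr.2.trans hb⟩)
  simpa [mul_comm] using this

lemma xiD_continuousOn {β : ℕ → ℝ} (hβ : ValidBeta β) : ContinuousOn (xiD β) (Icc 0 1) := by
  unfold xiD
  refine continuousOn_tsum (u := fun p : ℕ => (p : ℝ) * (p : ℝ) * β p ^ 2) (fun p => by fun_prop)
    (summ_bound hβ) (fun p r hr => ?_)
  have h2 : r ^ (p - 1) ≤ 1 := pow_le_one₀ hr.1 hr.2
  have h3 : 0 ≤ r ^ (p - 1) := pow_nonneg hr.1 _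
  rw [Real.norm_of_nonneg (by positivity)]
  have h5 : (p : ℝ) * β p ^ 2 * r ^ (p - 1) ≤ (p : ℝ) * β p ^ 2 :=
    mul_le_of_le_one_right (by positivity) h2
  refine h5.trans ?_
  rcases Nat.eq_zero_or_pos p with h | h
  · simp [h]
  · have : (1 : ℝ) ≤ p := by exact_mod_cast h
    have h7 : 0 ≤ (p : ℝ) * β p ^ 2 := by positivity
    nlinarith

end

section

/-- the standard Gaussian measure -/
abbrev stdG : Measure ℝ := gaussianReal 0 1

structure Nice (f : ℝ → ℝ) : Prop where
  lip : ∀ x y, |f x - f y| ≤ |x - y|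
  conv : ConvexOn ℝ univ f
  sec : ∀ x y, exp (f (x + y)) + exp (f (x - y)) ≤ 2 * cosh y * exp (f x)

/-- the one step operator -/
def opG (m σ : ℝ) (f : ℝ → ℝ) (x : ℝ) : ℝ := m⁻¹ * log (∫ z, exp (m * f (x + z * σ)) ∂stdG)

lemma integrable_exp_abs (K : ℝ) (hK : 0 ≤ K) : Integrable (fun z : ℝ => exp (K * |z|)) stdG := by
  have h1 : Integrable (fun z : ℝ => exp (K * z) + exp (-K * z)) stdG :=
    (integrable_exp_mul_gaussianReal K).add (integrable_exp_mul_gaussianReal (-K))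
  refine h1.mono' (by fun_prop) (Eventually.of_forall fun z => ?_)
  rw [Real.norm_of_nonneg (exp_pos _).le]
  rcases abs_cases z with h | h
  · rw [h.1]
    have := exp_pos (-K * z)
    linarith
  · rw [h.1]
    have := exp_pos (K * z)
    have h3 : K * -z = -K * z := by ring
    rw [h3]
    linarith

lemma gInt {F : ℝ → ℝ} (hF : Continuous F) (C K : ℝ) (hK : 0 ≤ K)
    (h : ∀ z, |F z| ≤ C * exp (K * |z|)) : Integrable F stdG :=
  ((integrable_exp_abs K hK).const_mul C).mono' hF.aestronglyMeasurable
    (Eventually.of_forall fun z => h z)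

namespace Nice
variable {f : ℝ → ℝ}

lemma cont (hf : Nice f) : Continuous f := by
  refine (LipschitzWith.of_dist_le_mul (K := 1) fun x y => ?_).continuous
  simpa [Real.dist_eq] using hf.lip x y

lemma growth (hf : Nice f) (x : ℝ) : |f x| ≤ |f 0| + |x| := by
  have := hf.lip x 0
  rw [sub_zero] at this
  have h2 : |f x| ≤ |f x - f 0| + |f 0| := by
    have := abs_add_le (f x - f 0) (f 0)
    simpa using this
  linarith

lemma growth_mul (hf : Nice f) (x σ z : ℝ) : |f (x + z * σ)| ≤ |f x| + |σ| * |z| := by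
  have := hf.lip (x + z * σ) x
  rw [add_sub_cancel_left, abs_mul] at this
  have h2 : |f (x + z * σ)| ≤ |f (x + z * σ) - f x| + |f x| := by
    have := abs_add_le (f (x + z * σ) - f x) (f x)
    simpa using this
  linarith [mul_comm |z| |σ|]

lemma exp_int (hf : Nice f) {m : ℝ} (hm : 0 ≤ m) (x σ : ℝ) :
    Integrable (fun z => exp (m * f (x + z * σ))) stdG := by
  have hc := hf.cont
  refine gInt (by fun_prop) (exp (m * |f x|)) (m * |σ|) (by positivity) fun z => ?_
  rw [abs_of_pos (exp_pos _), ← exp_add]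
  refine exp_le_exp.2 ?_
  have h1 := hf.growth_mul x σ z
  have h2 := le_abs_self (f (x + z * σ))
  nlinarith

lemma int (hf : Nice f) (x σ : ℝ) : Integrable (fun z => f (x + z * σ)) stdG := by
  have hc := hf.cont
  refine gInt (by fun_prop) (|f x| + |σ|) 1 (by positivity) fun z => ?_
  have h1 := hf.growth_mul x σ z
  have h2 : 1 + |z| ≤ exp (1 * |z|) := by rw [one_mul, add_comm]; exact add_one_le_exp _
  have h3 := abs_nonneg (f x)
  have h4 := abs_nonneg σ
  have h5 := abs_nonneg z
  nlinarith

lemma I_pos (hf : Nice f) {m : ℝ} (hm : 0 ≤ m) (x σ : ℝ) :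
    0 < ∫ z, exp (m * f (x + z * σ)) ∂stdG := integral_exp_pos (hf.exp_int hm x σ)

lemma exp_opG (hf : Nice f) {m : ℝ} (hm : 0 < m) (x σ : ℝ) :
    exp (m * opG m σ f x) = ∫ z, exp (m * f (x + z * σ)) ∂stdG := by
  unfold opG
  rw [← mul_assoc, mul_inv_cancel₀ hm.ne', one_mul, exp_log (hf.I_pos hm.le x σ)]

lemma opG_le_iff (hf : Nice f) {m : ℝ} (hm : 0 < m) (x σ c : ℝ) :
    opG m σ f x ≤ c ↔ ∫ z, exp (m * f (x + z * σ)) ∂stdG ≤ exp (m * c) := by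
  rw [← hf.exp_opG hm, exp_le_exp]
  constructor
  · intro h; exact mul_le_mul_of_nonneg_left h hm.le
  · intro h; exact le_of_mul_le_mul_left h hm

/-- normalized integral -/
lemma norm_int (hf : Nice f) {m : ℝ} (hm : 0 < m) (x σ : ℝ) :
    ∫ z, exp (m * (f (x + z * σ) - opG m σ f x)) ∂stdG = 1 := by
  simp_rw [mul_sub, exp_sub]
  rw [integral_div, ← hf.exp_opG hm, div_self (exp_pos _).ne']

lemma norm_int' (hf : Nice f) {m : ℝ} (hm : 0 < m) (x σ : ℝ) :
    Integrable (fun z => exp (m * (f (x + z * σ) - opG m σ f x))) stdG := by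
  simp_rw [mul_sub, exp_sub]
  exact (hf.exp_int hm.le x σ).div_const _

lemma opG_lip (hf : Nice f) {m : ℝ} (hm : 0 < m) (σ x y : ℝ) :
    opG m σ f x ≤ opG m σ f y + |x - y| := by
  rw [hf.opG_le_iff hm, mul_add, exp_add, hf.exp_opG hm, ← integral_mul_const]
  refine integral_mono (hf.exp_int hm.le x σ) ((hf.exp_int hm.le y σ).mul_const _) fun z => ?_
  dsimp only
  rw [← exp_add, ← mul_add]
  refine exp_le_exp.2 (mul_le_mul_of_nonneg_left ?_ hm.le)
  have h1 := hf.lip (x + z * σ) (y + z * σ)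
  have h2 : x + z * σ - (y + z * σ) = x - y := by ring
  rw [h2] at h1
  linarith [le_abs_self (f (x + z * σ) - f (y + z * σ))]

lemma opG_nice (hf : Nice f) {m : ℝ} (hm : 0 < m) (hm1 : m ≤ 1) (σ : ℝ) : Nice (opG m σ f) := by
  refine ⟨fun x y => ?_, ⟨convex_univ, fun x _ y _ a b ha hb hab => ?_⟩, fun x y => ?_⟩
  · rw [abs_le]
    have h1 := hf.opG_lip hm σ x y
    have h2 := hf.opG_lip hm σ y x
    rw [abs_sub_comm] at h2
    constructor <;> linarith
  · simp only [smul_eq_mul]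
    rw [hf.opG_le_iff hm]
    set A := opG m σ f x
    set B := opG m σ f y
    have h1 : ∫ z, exp (m * f (a * x + b * y + z * σ)) / exp (m * (a * A + b * B)) ∂stdG ≤
        ∫ z, (a * exp (m * (f (x + z * σ) - A)) + b * exp (m * (f (y + z * σ) - B))) ∂stdG := by
      refine integral_mono ((hf.exp_int hm.le _ σ).div_const _)
        (((hf.norm_int' hm x σ).const_mul a).add ((hf.norm_int' hm y σ).const_mul b)) fun z => ?_
      dsimp only
      rw [← exp_sub]
      have hc := convexOn_exp.2 (mem_univ (m * (f (x + z * σ) - A)))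
        (mem_univ (m * (f (y + z * σ) - B))) ha hb hab
      simp only [smul_eq_mul] at hc
      refine le_trans (exp_le_exp.2 ?_) hc
      have hcf := hf.conv.2 (mem_univ (x + z * σ)) (mem_univ (y + z * σ)) ha hb hab
      simp only [smul_eq_mul] at hcf
      have he : a * (x + z * σ) + b * (y + z * σ) = a * x + b * y + z * σ := by
        linear_combination (z * σ) * hab
      rw [he] at hcf
      nlinarith [mul_le_mul_of_nonneg_left hcf hm.le]
    rw [integral_div, integral_add ((hf.norm_int' hm x σ).const_mul a)
      ((hf.norm_int' hm y σ).const_mul b), integral_const_mul, integral_const_mul,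
      hf.norm_int hm, hf.norm_int hm, mul_one, mul_one, hab, div_le_one (exp_pos _)] at h1
    exact h1
  · set A := opG m σ f (x + y) with hA
    set B := opG m σ f (x - y) with hB
    set C := opG m σ f x with hC
    set D := exp A + exp B with hD
    have hDpos : 0 < D := by positivity
    set K := 2 * cosh y / D with hK
    have hcosh := cosh_pos y
    have hKpos : 0 < K := by positivity
    have h1 : ∫ z, (exp A / D * exp (m * (f (x + y + z * σ) - A)) +
          exp B / D * exp (m * (f (x - y + z * σ) - B))) ∂stdG ≤
        ∫ z, K ^ m * exp (m * f (x + z * σ)) ∂stdG := by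
      refine integral_mono (((hf.norm_int' hm _ σ).const_mul _).add
        ((hf.norm_int' hm _ σ).const_mul _)) ((hf.exp_int hm.le _ σ).const_mul _) fun z => ?_
      dsimp only
      have hcv := (Real.concaveOn_rpow hm.le hm1).2
        (show exp (f (x + y + z * σ) - A) ∈ Ici 0 from (exp_pos _).le)
        (show exp (f (x - y + z * σ) - B) ∈ Ici 0 from (exp_pos _).le)
        (show 0 ≤ exp A / D by positivity) (show 0 ≤ exp B / D by positivity)
        (by rw [← add_div, ← hD, div_self hDpos.ne'])
      simp only [smul_eq_mul] at hcv
      rw [← exp_mul, ← exp_mul, mul_comm _ m, mul_comm _ m] at hcv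
      refine hcv.trans ?_
      have hrw : K ^ m * exp (m * f (x + z * σ)) = (K * exp (f (x + z * σ))) ^ m := by
        rw [mul_rpow hKpos.le (exp_pos _).le, ← exp_mul, mul_comm m]
      rw [hrw]
      refine rpow_le_rpow (by positivity) ?_ hm.le
      have hs := hf.sec (x + z * σ) y
      have e1 : x + z * σ + y = x + y + z * σ := by ring
      have e2 : x + z * σ - y = x - y + z * σ := by ring
      rw [e1, e2] at hs
      have : exp A / D * exp (f (x + y + z * σ) - A) + exp B / D * exp (f (x - y + z * σ) - B)
          = (exp (f (x + y + z * σ)) + exp (f (x - y + z * σ))) / D := by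
        rw [exp_sub, exp_sub]
        have := exp_pos A
        have := exp_pos B
        field_simp
      rw [this, hK, div_mul_eq_mul_div]
      gcongr
    rw [integral_add ((hf.norm_int' hm _ σ).const_mul _) ((hf.norm_int' hm _ σ).const_mul _),
      integral_const_mul, integral_const_mul, integral_const_mul, hf.norm_int hm, hf.norm_int hm,
      ← hf.exp_opG hm, ← hC, mul_one, mul_one, ← add_div, ← hD, div_self hDpos.ne',
      mul_comm m, exp_mul, ← mul_rpow hKpos.le (exp_pos _).le] at h1
    have h2 : 1 ≤ K * exp C := by
      by_contra hlt
      push Not at hlt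
      have := rpow_lt_one (by positivity) hlt hm
      linarith
    rw [hK, div_mul_eq_mul_div, le_div_iff₀ hDpos, one_mul] at h2
    exact h2

lemma of_tendsto {F : ℕ → ℝ → ℝ} (hF : ∀ n, Nice (F n))
    (h : ∀ x, Tendsto (fun n => F n x) atTop (nhds (f x))) : Nice f := by
  refine ⟨fun x y => ?_, ⟨convex_univ, fun x _ y _ a b ha hb hab => ?_⟩, fun x y => ?_⟩
  · exact le_of_tendsto ((h x).sub (h y)).abs (Eventually.of_forall fun n => (hF n).lip x y)
  · exact le_of_tendsto_of_tendsto' (h _) (((h x).const_mul a).add ((h y).const_mul b))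
      fun n => (hF n).conv.2 (mem_univ x) (mem_univ y) ha hb hab
  · exact le_of_tendsto_of_tendsto' (((h _).rexp).add ((h _).rexp))
      ((h x).rexp.const_mul _) fun n => (hF n).sec x y

lemma log_cosh : Nice (fun x => log (cosh x)) := by
  refine ⟨?_, ⟨convex_univ, fun x _ y _ a b ha hb hab => ?_⟩, fun x y => ?_⟩
  · have key : ∀ x y : ℝ, log (cosh x) ≤ log (cosh y) + |x - y| := by
      intro x y
      rw [log_le_iff_le_exp (cosh_pos x), exp_add, exp_log (cosh_pos y), cosh_eq, cosh_eq]
      have h1 : exp x ≤ exp y * exp |x - y| := by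
        rw [← exp_add]; exact exp_le_exp.2 (by linarith [le_abs_self (x - y)])
      have h2 : exp (-x) ≤ exp (-y) * exp |x - y| := by
        rw [← exp_add]; exact exp_le_exp.2 (by linarith [neg_abs_le (x - y)])
      linarith
    intro x y
    rw [abs_le]
    have h1 := key x y
    have h2 := key y x
    rw [abs_sub_comm] at h2
    constructor <;> linarith
  · simp only [smul_eq_mul]
    rw [log_le_iff_le_exp (cosh_pos _)]
    set A := log (cosh x) with hA
    set B := log (cosh y) with hB
    have h1 := convexOn_exp.2 (mem_univ (x - A)) (mem_univ (y - B)) ha hb hab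
    have h2 := convexOn_exp.2 (mem_univ (-x - A)) (mem_univ (-y - B)) ha hb hab
    simp only [smul_eq_mul] at h1 h2
    have e1 : a * (x - A) + b * (y - B) = (a * x + b * y) - (a * A + b * B) := by ring
    have e2 : a * (-x - A) + b * (-y - B) = -(a * x + b * y) - (a * A + b * B) := by ring
    rw [e1, exp_sub, exp_sub, exp_sub] at h1
    rw [e2, exp_sub, exp_sub, exp_sub] at h2
    have hx : exp A = cosh x := exp_log (cosh_pos x)
    have hy : exp B = cosh y := exp_log (cosh_pos y)
    rw [hx, hy] at h1 h2
    have h3 : exp x / cosh x + exp (-x) / cosh x = 2 := by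
      rw [← add_div, div_eq_iff (cosh_pos x).ne', cosh_eq]; ring
    have h4 : exp y / cosh y + exp (-y) / cosh y = 2 := by
      rw [← add_div, div_eq_iff (cosh_pos y).ne', cosh_eq]; ring
    have h5 : cosh (a * x + b * y) / exp (a * A + b * B) ≤ 1 := by
      rw [cosh_eq, div_div, mul_comm (2:ℝ), ← div_div, add_div]
      nlinarith
    rwa [div_le_one (exp_pos _)] at h5
  · rw [exp_log (cosh_pos _), exp_log (cosh_pos _), exp_log (cosh_pos _), cosh_add, cosh_sub]
    linarith

lemma sec2 (hf : Nice f) (x y : ℝ) : f (x + y) + f (x - y) - 2 * f x ≤ y ^ 2 := by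
  have h := hf.sec x y
  have h1 : exp ((f (x + y) + f (x - y)) / 2) ≤ exp (y ^ 2 / 2 + f x) := by
    have h2 := convexOn_exp.2 (mem_univ (f (x + y))) (mem_univ (f (x - y)))
      (by norm_num : (0:ℝ) ≤ 1/2) (by norm_num : (0:ℝ) ≤ 1/2) (by norm_num)
    simp only [smul_eq_mul] at h2
    have e : (f (x + y) + f (x - y)) / 2 = 1 / 2 * f (x + y) + 1 / 2 * f (x - y) := by ring
    rw [e, exp_add (y ^ 2 / 2)]
    have h3 := mul_le_mul_of_nonneg_right (Real.cosh_le_exp_half_sq y) (exp_pos (f x)).le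
    linarith
  have := exp_le_exp.1 h1
  linarith

lemma exists_sub (hf : Nice f) (x : ℝ) : ∃ p, ∀ y, f x + p * y ≤ f (x + y) := by
  refine ⟨derivWithin f (Ioi x) x, fun y => ?_⟩
  rcases lt_trichotomy y 0 with hy | hy | hy
  · have h1 := hf.conv.slope_le_leftDeriv_of_mem_interior (mem_univ (x + y)) (y := x) (by simp)
      (by linarith)
    have h2 := hf.conv.leftDeriv_le_rightDeriv_of_mem_interior (x := x) (by simp)
    have h3 := h1.trans h2
    rw [slope_def_field] at h3
    have e : x - (x + y) = -y := by ring
    rw [e, div_le_iff₀ (by linarith)] at h3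
    linarith
  · simp [hy]
  · have h1 := hf.conv.rightDeriv_le_slope_of_mem_interior (x := x) (by simp) (mem_univ (x + y))
      (by linarith)
    rw [slope_def_field] at h1
    have e : x + y - x = y := by ring
    rw [e, le_div_iff₀ hy] at h1
    linarith

lemma sub_upper (hf : Nice f) {x p : ℝ} (hp : ∀ y, f x + p * y ≤ f (x + y)) (y : ℝ) :
    f (x + y) ≤ f x + p * y + y ^ 2 := by
  have h1 := hf.sec2 x y
  have h2 := hp (-y)
  rw [← sub_eq_add_neg] at h2
  linarith

lemma hasDeriv (hf : Nice f) {x p : ℝ} (hp : ∀ y, f x + p * y ≤ f (x + y)) :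
    HasDerivAt f p x := by
  rw [hasDerivAt_iff_isLittleO_nhds_zero]
  have h1 : (fun h : ℝ => f (x + h) - f x - h • p) =O[nhds 0] fun h : ℝ => h ^ 2 := by
    refine Asymptotics.IsBigO.of_bound 1 (Eventually.of_forall fun h => ?_)
    have h1 := hp h
    have h2 := hf.sub_upper hp h
    simp only [smul_eq_mul]
    rw [Real.norm_eq_abs, Real.norm_eq_abs, abs_of_nonneg (by linarith), abs_of_nonneg (sq_nonneg _)]
    linarith
  refine h1.trans_isLittleO ?_
  have := Asymptotics.isLittleO_pow_id (𝕜 := ℝ) (n := 2) (by norm_num)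
  simpa using this

lemma deriv_lower (hf : Nice f) (x y : ℝ) : f x + deriv f x * y ≤ f (x + y) := by
  obtain ⟨p, hp⟩ := hf.exists_sub x
  rw [(hf.hasDeriv hp).deriv]
  exact hp y

lemma deriv_upper (hf : Nice f) (x y : ℝ) : f (x + y) ≤ f x + deriv f x * y + y ^ 2 :=
  hf.sub_upper (hf.deriv_lower x) y

lemma deriv_abs_le (hf : Nice f) (x : ℝ) : |deriv f x| ≤ 1 := by
  rw [abs_le]
  have h1 := hf.deriv_lower x 1
  have h2 := hf.deriv_lower x (-1)
  have h3 := abs_le.1 (hf.lip (x + 1) x)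
  have h4 := abs_le.1 (hf.lip (x + -1) x)
  simp at h3 h4
  constructor <;> linarith

lemma deriv_close_aux {g : ℝ → ℝ} (hf : Nice f) (hg : Nice g) {ε : ℝ} (hε : 0 < ε)
    (h : ∀ x, |f x - g x| ≤ ε) (x : ℝ) : deriv f x ≤ deriv g x + 3 * √ε := by
  have h0 := sqrt_pos.2 hε
  have hs := sq_sqrt hε.le
  have h1 := hf.deriv_lower x (√ε)
  have h2 := hg.deriv_upper x (√ε)
  have h3 := abs_le.1 (h x)
  have h4 := abs_le.1 (h (x + √ε))
  have h5 : (deriv f x - deriv g x - 3 * √ε) * √ε ≤ 0 := by nlinarith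
  by_contra hlt
  push Not at hlt
  have : 0 < (deriv f x - deriv g x - 3 * √ε) * √ε := mul_pos (by linarith) h0
  linarith

lemma deriv_close {g : ℝ → ℝ} (hf : Nice f) (hg : Nice g) {ε : ℝ} (hε : 0 < ε)
    (h : ∀ x, |f x - g x| ≤ ε) (x : ℝ) : |deriv f x - deriv g x| ≤ 3 * √ε := by
  rw [abs_le]
  have h1 := hf.deriv_close_aux hg hε h x
  have h2 := hg.deriv_close_aux hf hε (fun x => by rw [abs_sub_comm]; exact h x) x
  constructor <;> linarith

lemma deriv_lip_aux (hf : Nice f) (x : ℝ) {y : ℝ} (hy : 0 < y) :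
    |deriv f (x + y) - deriv f x| ≤ 4 * y := by
  have h1 := hf.deriv_lower (x + y) y
  have h2 := hf.deriv_upper x (2 * y)
  have h3 := hf.deriv_lower x y
  have h4 := hf.deriv_lower (x + y) (-y)
  have h5 := hf.deriv_upper x y
  have e1 : x + y + y = x + 2 * y := by ring
  have e2 : x + y + -y = x := by ring
  rw [e1] at h1
  rw [e2] at h4
  have h6 : (deriv f (x + y) - deriv f x - 4 * y) * y ≤ 0 := by nlinarith
  have h7 : 0 ≤ (deriv f (x + y) - deriv f x + 4 * y) * y := by nlinarith
  rw [abs_le]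
  constructor
  · by_contra hlt
    push Not at hlt
    have : (deriv f (x + y) - deriv f x + 4 * y) * y < 0 := mul_neg_of_neg_of_pos (by linarith) hy
    linarith
  · by_contra hlt
    push Not at hlt
    have : 0 < (deriv f (x + y) - deriv f x - 4 * y) * y := mul_pos (by linarith) hy
    linarith

lemma deriv_lip (hf : Nice f) (x y : ℝ) : |deriv f x - deriv f y| ≤ 4 * |x - y| := by
  rcases lt_trichotomy x y with h | h | h
  · have := hf.deriv_lip_aux x (y := y - x) (by linarith)
    rw [abs_sub_comm, abs_sub_comm x, abs_of_pos (by linarith : 0 < y - x)]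
    simpa using this
  · simp [h]
  · have := hf.deriv_lip_aux y (y := x - y) (by linarith)
    rw [abs_of_pos (by linarith : 0 < x - y)]
    simpa using this

end Nice

end

section

lemma gauss_shift (F : ℝ → ℝ) (a : ℝ) :
    ∫ z, F z ∂stdG = ∫ z, F (z + a) * exp (-(a * z) - a ^ 2 / 2) ∂stdG := by
  rw [integral_gaussianReal_eq_integral_smul one_ne_zero,
    integral_gaussianReal_eq_integral_smul one_ne_zero,
    ← integral_add_right_eq_self (μ := volume) _ a]
  refine integral_congr_ae (Eventually.of_forall fun z => ?_)
  simp only [gaussianPDFReal, smul_eq_mul, NNReal.coe_one, sub_zero, mul_one]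
  have : exp (-(z + a) ^ 2 / 2) = exp (-z ^ 2 / 2) * exp (-(a * z) - a ^ 2 / 2) := by
    rw [← exp_add]; congr 1; ring
  rw [this]
  ring

lemma gauss_scale {F : ℝ → ℝ} (hF : Continuous F) {v : ℝ} (hv : 0 ≤ v) :
    ∫ z, F (z * √v) ∂stdG = ∫ y, F y ∂(gaussianReal 0 (Real.toNNReal v)) := by
  have h := gaussianReal_map_mul_const (μ := 0) (v := 1) (√v)
  have h2 : gaussianReal (√v * 0) (NNReal.mk (√v ^ 2) (sq_nonneg _) * 1)
      = gaussianReal 0 (Real.toNNReal v) := by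
    rw [gaussianReal_ext_iff]
    refine ⟨by simp, ?_⟩
    ext
    simp [sq_sqrt hv, hv]
  rw [h2] at h
  rw [← h, integral_map (by fun_prop) hF.aestronglyMeasurable]

lemma integrable_scale {F : ℝ → ℝ} (hF : Continuous F) {v : ℝ} (hv : 0 ≤ v) :
    Integrable F (gaussianReal 0 (Real.toNNReal v)) ↔ Integrable (fun z => F (z * √v)) stdG := by
  have h := gaussianReal_map_mul_const (μ := 0) (v := 1) (√v)
  have h2 : gaussianReal (√v * 0) (NNReal.mk (√v ^ 2) (sq_nonneg _) * 1)
      = gaussianReal 0 (Real.toNNReal v) := by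
    rw [gaussianReal_ext_iff]
    refine ⟨by simp, ?_⟩
    ext
    simp [sq_sqrt hv, hv]
  rw [h2] at h
  rw [← h, integrable_map_measure hF.aestronglyMeasurable (by fun_prop)]
  rfl

namespace Nice
variable {f : ℝ → ℝ}

lemma opG_comp (hf : Nice f) {m : ℝ} (hm : 0 < m) {v w : ℝ} (hv : 0 ≤ v) (hw : 0 ≤ w)
    (x : ℝ) : opG m √v (opG m √w f) x = opG m √(v + w) f x := by
  have hc := hf.cont
  have e1 : opG m √v (opG m √w f) x
      = m⁻¹ * log (∫ z, ∫ z', exp (m * f (x + z * √v + z' * √w)) ∂stdG ∂stdG) := by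
    unfold opG
    congr 2
    refine integral_congr_ae (Eventually.of_forall fun z => ?_)
    exact hf.exp_opG hm (x + z * √v) √w
  rw [e1]
  unfold opG
  congr 2
  have e2 : ∫ z, exp (m * f (x + z * √(v + w))) ∂stdG
      = ∫ y, exp (m * f (x + y)) ∂(gaussianReal 0 (Real.toNNReal (v + w))) :=
    gauss_scale (F := fun y => exp (m * f (x + y))) (by fun_prop) (by positivity)
  have hIntg : Integrable (fun y => exp (m * f (x + y))) (gaussianReal 0 (Real.toNNReal (v + w))) := by
    rw [integrable_scale (by fun_prop) (by positivity)]
    exact hf.exp_int hm.le x _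
  have e3 : gaussianReal 0 (Real.toNNReal (v + w))
      = (gaussianReal 0 (Real.toNNReal v)) ∗ (gaussianReal 0 (Real.toNNReal w)) := by
    rw [gaussianReal_conv_gaussianReal, Real.toNNReal_add hv hw, add_zero]
  rw [e2]
  rw [e3] at hIntg ⊢
  rw [integral_conv hIntg]
  have e4 : ∀ y, ∫ y', exp (m * f (x + (y + y'))) ∂(gaussianReal 0 (Real.toNNReal w))
      = exp (m * opG m √w f (x + y)) := by
    intro y
    rw [← gauss_scale (F := fun y' => exp (m * f (x + (y + y')))) (by fun_prop) hw,
      hf.exp_opG hm]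
    simp_rw [add_assoc]
  simp_rw [e4]
  have hcc : Continuous (opG m √w f) := by
    refine (LipschitzWith.of_dist_le_mul (K := 1) fun x y => ?_).continuous
    rw [Real.dist_eq, Real.dist_eq, NNReal.coe_one, one_mul, abs_le]
    have h1 := hf.opG_lip hm √w x y
    have h2 := hf.opG_lip hm √w y x
    rw [abs_sub_comm] at h2
    constructor <;> linarith
  rw [← gauss_scale (F := fun y => exp (m * opG m √w f (x + y))) (by fun_prop) hv]
  simp_rw [hf.exp_opG hm]

/-- shifted form of the partition integral -/
lemma shifted (f : ℝ → ℝ) (m v u x : ℝ) (hv : 0 ≤ v) :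
    ∫ z, exp (m * f (x + z * √v)) ∂stdG =
      ∫ z, exp (m * (f (x + m * v * u + z * √v) - u * √v * z) - m ^ 2 * v * u ^ 2 / 2) ∂stdG := by
  rw [gauss_shift _ (m * √v * u)]
  refine integral_congr_ae (Eventually.of_forall fun z => ?_)
  dsimp only
  have e : x + (z + m * √v * u) * √v = x + m * v * u + z * √v := by
    linear_combination m * u * (mul_self_sqrt hv)
  rw [e, ← exp_add]
  congr 1
  have := sq_sqrt hv
  linear_combination (-m ^ 2 * u ^ 2 / 2) * this

lemma int_id : ∫ z, z ∂stdG = 0 := integral_id_gaussianReal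

lemma integrable_id : Integrable (fun z : ℝ => z) stdG := by
  refine gInt continuous_id 1 1 (by norm_num) fun z => ?_
  have := add_one_le_exp |z|
  simp
  linarith

lemma sq_le_exp (z : ℝ) : z ^ 2 ≤ 2 * exp |z| := by
  have := quadratic_le_exp_of_nonneg (abs_nonneg z)
  rw [sq_abs] at this
  have h2 := abs_nonneg z
  linarith

lemma integrable_sq : Integrable (fun z : ℝ => z ^ 2) stdG := by
  refine gInt (by fun_prop) 2 1 (by norm_num) fun z => ?_
  rw [abs_of_nonneg (sq_nonneg z), one_mul]
  exact sq_le_exp z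

lemma upper (hf : Nice f) {m : ℝ} (hm : 0 < m) {v : ℝ} (hv : 0 ≤ v) (u x : ℝ) :
    ∫ z, f (x + m * v * u + z * √v) ∂stdG - m / 2 * v * u ^ 2 ≤ opG m √v f x := by
  have hc := hf.cont
  set V : ℝ → ℝ := fun z => m * (f (x + m * v * u + z * √v) - u * √v * z) - m ^ 2 * v * u ^ 2 / 2
  have hVi : Integrable V stdG :=
    (((hf.int _ _).sub (integrable_id.const_mul _)).const_mul m).sub (integrable_const _)
  have hVint : ∫ z, V z ∂stdG
      = m * (∫ z, f (x + m * v * u + z * √v) ∂stdG - m / 2 * v * u ^ 2) := by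
    simp only [V]
    have hA : Integrable (fun z => f (x + m * v * u + z * √v) - u * √v * z) stdG :=
      (hf.int _ _).sub (integrable_id.const_mul _)
    rw [integral_sub (hA.const_mul m)
      (integrable_const _), integral_const_mul, integral_sub (hf.int _ _)
      (integrable_id.const_mul _), integral_const_mul, int_id]
    simp
    ring
  set c := ∫ z, f (x + m * v * u + z * √v) ∂stdG - m / 2 * v * u ^ 2
  have hVe : Integrable (fun z => exp (V z)) stdG := by
    have h1 : 0 < ∫ z, exp (V z) ∂stdG := by
      rw [← shifted f m v u x hv]; exact hf.I_pos hm.le _ _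
    by_contra hni
    rw [integral_undef hni] at h1
    exact lt_irrefl _ h1
  have h1 : ∫ z, (exp (m * c) * (1 + (V z - m * c))) ∂stdG ≤ ∫ z, exp (V z) ∂stdG := by
    refine integral_mono (((integrable_const _).add (hVi.sub (integrable_const _))).const_mul _)
      hVe fun z => ?_
    have : exp (V z) = exp (m * c) * exp (V z - m * c) := by
      rw [← exp_add]; congr 1; ring
    dsimp only
    rw [this]
    refine mul_le_mul_of_nonneg_left ?_ (exp_pos _).le
    linarith [add_one_le_exp (V z - m * c)]
  have hB : Integrable (fun z => V z - m * c) stdG := hVi.sub (integrable_const _)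
  rw [integral_const_mul, integral_add (integrable_const _) hB,
    integral_sub hVi (integrable_const _), hVint] at h1
  simp only [integral_const, probReal_univ, smul_eq_mul, one_mul, sub_self, add_zero, mul_one] at h1
  rw [← shifted f m v u x hv, ← hf.exp_opG hm, exp_le_exp] at h1
  exact le_of_mul_le_mul_left h1 hm

lemma exp_taylor (y : ℝ) : exp y ≤ 1 + y + y ^ 2 * exp |y| := by
  have key : ∀ y : ℝ, 0 ≤ y → exp y ≤ 1 + y + y ^ 2 * exp y := by
    intro y hy
    have h1 : 1 - y ≤ exp (-y) := one_sub_le_exp_neg y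
    have h2 : (1 - y) * exp y ≤ 1 := by
      have := mul_le_mul_of_nonneg_right h1 (exp_pos y).le
      rwa [← exp_add, neg_add_cancel, exp_zero] at this
    nlinarith [mul_le_mul_of_nonneg_left h2 hy]
  rcases le_total 0 y with h | h
  · rw [abs_of_nonneg h]; exact key y h
  · have h3 := quadratic_le_exp_of_nonneg (neg_nonneg.2 h)
    have h4 : exp y * exp (-y) = 1 := by rw [← exp_add]; simp
    have h5 := exp_pos y
    rw [abs_of_nonpos h]
    have h6 : (1:ℝ) ≤ exp (-y) := one_le_exp (neg_nonneg.2 h)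
    have h7 : exp y ≤ 1 + y + y ^ 2 := by
      have := Real.abs_exp_sub_one_sub_id_le (x := y)
      by_cases hy : |y| ≤ 1
      · have := (abs_le.1 (this hy)).2; linarith
      · rw [abs_of_nonpos h] at hy
        have : exp y ≤ 1 := exp_le_one_iff.2 h
        nlinarith
    nlinarith [sq_nonneg y]

lemma lower : ∃ C : ℝ, 0 ≤ C ∧ ∀ f : ℝ → ℝ, Nice f → ∀ m : ℝ, 0 < m → m ≤ 1 → ∀ v : ℝ, 0 ≤ v →
    v ≤ 1 → ∀ x : ℝ, opG m √v f x ≤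
      ∫ z, f (x + m * v * deriv f x + z * √v) ∂stdG - m / 2 * v * deriv f x ^ 2 + C * v ^ 2 := by
  set K := ∫ z : ℝ, (3 + 2 * z ^ 2) ∂stdG with hK
  have hK0 : 0 ≤ K := integral_nonneg fun z => by positivity
  have hKi : Integrable (fun z : ℝ => 3 + 2 * z ^ 2) stdG :=
    (integrable_const _).add (integrable_sq.const_mul _)
  set b : ℝ → ℝ := fun z => (3 + 2 * z ^ 2 + K) ^ 2 * exp (1 + 2 * |z| + K) with hb
  have hbi : Integrable b stdG := by
    refine gInt (by fun_prop) ((7 + K) ^ 2 * exp (1 + K)) 4 (by norm_num) fun z => ?_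
    have h1 := sq_le_exp z
    have h0 : 1 ≤ exp |z| := one_le_exp (abs_nonneg z)
    have h2 : 3 + 2 * z ^ 2 + K ≤ (7 + K) * exp |z| := by nlinarith
    have h3 : 0 ≤ 3 + 2 * z ^ 2 + K := by positivity
    rw [abs_of_nonneg (by positivity)]
    calc b z ≤ ((7 + K) * exp |z|) ^ 2 * exp (1 + 2 * |z| + K) := by
          simp only [hb]; gcongr
      _ = (7 + K) ^ 2 * exp (1 + K) * exp (4 * |z|) := by
          rw [mul_pow, ← exp_nat_mul, mul_assoc, mul_assoc, ← exp_add, ← exp_add]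
          congr 2; push_cast; ring
  refine ⟨∫ z, b z ∂stdG, integral_nonneg fun z => by simp only [hb]; positivity, ?_⟩
  intro f hf m hm hm1 v hv hv1 x
  set C := ∫ z, b z ∂stdG with hC
  set u := deriv f x with hu
  have hu1 : |u| ≤ 1 := hf.deriv_abs_le x
  have hu2 : u ^ 2 ≤ 1 := by rw [← sq_abs]; exact pow_le_one₀ (abs_nonneg _) hu1
  have hfc := hf.cont
  have hs0 := sqrt_nonneg v
  have hs1 : √v ≤ 1 := by rw [← sqrt_one]; exact sqrt_le_sqrt hv1
  have hsq := sq_sqrt hv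
  set V : ℝ → ℝ := fun z => f (x + m * v * u + z * √v) - u * √v * z with hV
  set c := ∫ z, V z ∂stdG with hc
  have hVi : Integrable V stdG := (hf.int _ _).sub (integrable_id.const_mul _)
  have hcf : c = ∫ z, f (x + m * v * u + z * √v) ∂stdG := by
    rw [hc]; simp only [hV]
    rw [integral_sub (hf.int _ _) (integrable_id.const_mul _), integral_const_mul, int_id]
    simp
  have hmu : 0 ≤ m * v * u ^ 2 := by positivity
  have hmu1 : m * v * u ^ 2 ≤ v := by
    calc m * v * u ^ 2 ≤ 1 * v * 1 := by gcongr
      _ = v := by ring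
  have hV1 : ∀ z, 0 ≤ V z - f x := by
    intro z
    have := hf.deriv_lower x (m * v * u + z * √v)
    rw [← hu, ← add_assoc] at this
    simp only [hV]
    nlinarith
  have hV2 : ∀ z, V z - f x ≤ v * (3 + 2 * z ^ 2) := by
    intro z
    have := hf.deriv_upper x (m * v * u + z * √v)
    rw [← hu, ← add_assoc] at this
    have h2 : (m * v * u + z * √v) ^ 2 ≤ 2 * v + 2 * (v * z ^ 2) := by
      have h3 : (m * v * u + z * √v) ^ 2 ≤ 2 * (m * v * u) ^ 2 + 2 * (z * √v) ^ 2 := by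
        nlinarith [sq_nonneg (m * v * u - z * √v)]
      have h4 : (z * √v) ^ 2 = v * z ^ 2 := by rw [mul_pow, hsq]; ring
      have h5 : (m * v * u) ^ 2 = (m * v) * (m * v * u ^ 2) := by ring
      have h6 : (m * v) * (m * v * u ^ 2) ≤ 1 * v := by
        apply mul_le_mul _ hmu1 hmu (by norm_num)
        nlinarith
      linarith
    simp only [hV]
    nlinarith
  have hc1 : 0 ≤ c - f x := by
    have : ∫ z, (V z - f x) ∂stdG = c - f x := by
      rw [integral_sub hVi (integrable_const _)]; simp [hc]
    rw [← this]; exact integral_nonneg hV1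
  have hc2 : c - f x ≤ v * K := by
    have : ∫ z, (V z - f x) ∂stdG = c - f x := by
      rw [integral_sub hVi (integrable_const _)]; simp [hc]
    rw [← this, hK, ← integral_const_mul]
    exact integral_mono (hVi.sub (integrable_const _)) (hKi.const_mul _) hV2
  have hS1 : ∀ z, |V z - c| ≤ v * (3 + 2 * z ^ 2 + K) := by
    intro z
    have h1 := hV1 z
    have h2 := hV2 z
    have h3 : 0 ≤ v * K := by positivity
    have h4 : 0 ≤ v * (3 + 2 * z ^ 2) := by positivity
    rw [abs_le]
    constructor <;> nlinarith
  have hS2 : ∀ z, |V z - c| ≤ 1 + 2 * |z| + K := by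
    intro z
    have h1 := hV1 z
    have h3 : V z - f x ≤ 1 + 2 * |z| := by
      have h4 := hf.lip (x + m * v * u + z * √v) x
      have h5 : x + m * v * u + z * √v - x = m * v * u + z * √v := by ring
      rw [h5] at h4
      have h6 := abs_add_le (m * v * u) (z * √v)
      have h7 : |m * v * u| ≤ 1 := by
        rw [abs_mul, abs_of_nonneg (by positivity : 0 ≤ m * v)]
        have : m * v ≤ 1 := by nlinarith
        nlinarith [abs_nonneg u]
      have h8 : |z * √v| ≤ |z| := by
        rw [abs_mul, abs_of_nonneg hs0]
        nlinarith [abs_nonneg z]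
      have h9 : |u * √v * z| ≤ |z| := by
        rw [mul_assoc, abs_mul, mul_comm (√v)]
        nlinarith [abs_nonneg (z * √v), abs_nonneg u]
      have h10 := neg_abs_le (u * √v * z)
      have h11 := le_abs_self (f (x + m * v * u + z * √v) - f x)
      simp only [hV]
      linarith
    have h4 : v * K ≤ K := by nlinarith
    have h5 := abs_nonneg z
    rw [abs_le]
    constructor <;> linarith
  rw [hf.opG_le_iff hm, shifted f m v u x hv]
  have hle : ∫ z, exp (m * (V z - c)) ∂stdG ≤ ∫ z, (1 + m * (V z - c) + m * (v ^ 2 * b z)) ∂stdG := by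
    refine integral_mono_of_nonneg (Eventually.of_forall fun z => (exp_pos _).le)
      (((integrable_const _).add ((hVi.sub (integrable_const _)).const_mul _)).add
        ((hbi.const_mul _).const_mul _)) (Eventually.of_forall fun z => ?_)
    dsimp only
    refine (exp_taylor _).trans ?_
    have h1 : (m * (V z - c)) ^ 2 * exp |m * (V z - c)| ≤ m * (v ^ 2 * b z) := by
      have h2 : |m * (V z - c)| ≤ 1 + 2 * |z| + K := by
        rw [abs_mul, abs_of_pos hm]
        have := hS2 z
        nlinarith [abs_nonneg (V z - c)]
      have h3 : (m * (V z - c)) ^ 2 ≤ m * (v * (3 + 2 * z ^ 2 + K)) ^ 2 := by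
        rw [mul_pow, ← sq_abs (V z - c)]
        have h4 : |V z - c| ^ 2 ≤ (v * (3 + 2 * z ^ 2 + K)) ^ 2 := by
          have := hS1 z
          gcongr
        have h5 : m ^ 2 ≤ m := by nlinarith
        exact mul_le_mul h5 h4 (by positivity) hm.le
      calc (m * (V z - c)) ^ 2 * exp |m * (V z - c)|
          ≤ m * (v * (3 + 2 * z ^ 2 + K)) ^ 2 * exp (1 + 2 * |z| + K) := by gcongr
        _ = m * (v ^ 2 * b z) := by simp only [hb]; ring
    linarith
  have hval : ∫ z, (1 + m * (V z - c) + m * (v ^ 2 * b z)) ∂stdG = 1 + m * (v ^ 2 * C) := by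
    have hB : Integrable (fun z => V z - c) stdG := hVi.sub (integrable_const _)
    have hD : Integrable (fun z => 1 + m * (V z - c)) stdG :=
      (integrable_const _).add (hB.const_mul _)
    rw [integral_add hD ((hbi.const_mul _).const_mul _),
      integral_add (integrable_const _) (hB.const_mul _),
      integral_const_mul, integral_const_mul, integral_const_mul,
      integral_sub hVi (integrable_const _)]
    simp [hc, hC]
  rw [hval] at hle
  have hle2 : ∫ z, exp (m * (V z - c)) ∂stdG ≤ exp (m * (v ^ 2 * C)) := by
    linarith [add_one_le_exp (m * (v ^ 2 * C))]
  have e1 : ∀ z, exp (m * (f (x + m * v * u + z * √v) - u * √v * z) - m ^ 2 * v * u ^ 2 / 2)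
      = exp (m * (V z - c)) * exp (m * c - m ^ 2 * v * u ^ 2 / 2) := by
    intro z
    rw [← exp_add]; congr 1; simp only [hV]; ring
  simp_rw [e1]
  rw [integral_mul_const, ← hcf]
  have e2 : exp (m * (c - m / 2 * v * u ^ 2 + C * v ^ 2))
      = exp (m * (v ^ 2 * C)) * exp (m * c - m ^ 2 * v * u ^ 2 / 2) := by
    rw [← exp_add]; congr 1; ring
  rw [e2]
  exact mul_le_mul_of_nonneg_right hle2 (exp_pos _).le

lemma time_reg : ∃ C : ℝ, 0 ≤ C ∧ ∀ f : ℝ → ℝ, Nice f → ∀ m : ℝ, 0 < m → m ≤ 1 → ∀ v : ℝ, 0 ≤ v →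
    v ≤ 1 → ∀ x : ℝ, |opG m √v f x - f x| ≤ C * v := by
  obtain ⟨C, hC0, hC⟩ := lower
  set K := ∫ z : ℝ, (3 + 2 * z ^ 2) ∂stdG with hK
  have hKi : Integrable (fun z : ℝ => 3 + 2 * z ^ 2) stdG :=
    (integrable_const _).add (integrable_sq.const_mul _)
  have hK0 : 0 ≤ K := integral_nonneg fun z => by positivity
  refine ⟨C + K, by positivity, fun f hf m hm hm1 v hv hv1 x => ?_⟩
  have hlow : f x ≤ opG m √v f x := by
    have h1 := hf.upper hm hv 0 x
    simp only [mul_zero, add_zero, ne_eq, OfNat.ofNat_ne_zero, not_false_eq_true, zero_pow,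
      sub_zero] at h1
    refine le_trans ?_ h1
    have h2 : ∫ z, (f x + deriv f x * (z * √v)) ∂stdG ≤ ∫ z, f (x + z * √v) ∂stdG :=
      integral_mono ((integrable_const _).add ((integrable_id.mul_const _).const_mul _))
        (hf.int _ _) fun z => hf.deriv_lower x _
    rw [integral_add (integrable_const _) ((integrable_id.mul_const _).const_mul _),
      integral_const_mul, integral_mul_const, int_id] at h2
    simpa using h2
  have hup := hC f hf m hm hm1 v hv hv1 x
  set u := deriv f x with hu
  have hu1 : |u| ≤ 1 := hf.deriv_abs_le x
  have hu2 : u ^ 2 ≤ 1 := by rw [← sq_abs]; exact pow_le_one₀ (abs_nonneg _) hu1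
  have hsq := sq_sqrt hv
  have hmu : 0 ≤ m * v * u ^ 2 := by positivity
  have hmu1 : m * v * u ^ 2 ≤ v := by
    calc m * v * u ^ 2 ≤ 1 * v * 1 := by gcongr
      _ = v := by ring
  have h3 : ∫ z, f (x + m * v * u + z * √v) ∂stdG
      ≤ ∫ z, (f x + u * √v * z + v * (3 + 2 * z ^ 2)) ∂stdG := by
    refine integral_mono (hf.int _ _) (((integrable_const _).add (integrable_id.const_mul _)).add
      (hKi.const_mul _)) fun z => ?_
    have := hf.deriv_upper x (m * v * u + z * √v)
    rw [← hu, ← add_assoc] at this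
    have h2 : (m * v * u + z * √v) ^ 2 ≤ 2 * v + 2 * (v * z ^ 2) := by
      have h3 : (m * v * u + z * √v) ^ 2 ≤ 2 * (m * v * u) ^ 2 + 2 * (z * √v) ^ 2 := by
        nlinarith [sq_nonneg (m * v * u - z * √v)]
      have h4 : (z * √v) ^ 2 = v * z ^ 2 := by rw [mul_pow, hsq]; ring
      have h5 : (m * v * u) ^ 2 = (m * v) * (m * v * u ^ 2) := by ring
      have h6 : (m * v) * (m * v * u ^ 2) ≤ 1 * v := by
        apply mul_le_mul _ hmu1 hmu (by norm_num)
        nlinarith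
      linarith
    dsimp only
    nlinarith
  have hE : Integrable (fun z => f x + u * √v * z) stdG :=
    (integrable_const _).add (integrable_id.const_mul _)
  rw [integral_add hE (hKi.const_mul _),
    integral_add (integrable_const _) (integrable_id.const_mul _), integral_const_mul,
    integral_const_mul, int_id] at h3
  simp only [integral_const, probReal_univ, smul_eq_mul, one_mul, mul_zero, add_zero] at h3
  rw [← hK] at h3
  have h4 : C * v ^ 2 ≤ C * v := by
    have : v ^ 2 ≤ v := by nlinarith
    exact mul_le_mul_of_nonneg_left this hC0
  rw [abs_of_nonneg (by linarith)]
  nlinarith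

end Nice

lemma gStep_eq (β : ℕ → ℝ) (Φ : ℝ → ℝ → ℝ) {m : ℝ} (hm : 0 < m) (t s x : ℝ) :
    gStep β Φ m t s x = opG m √(xiD β t - xiD β s) (Φ t) x := by
  unfold gStep opG
  rw [if_neg hm.ne']

end

section

lemma distF_nonneg (ν : Measure ℝ) (r : ℝ) : 0 ≤ distF ν r := ENNReal.toReal_nonneg

lemma distF_le_one {ν : Measure ℝ} (h : MemM ν) (r : ℝ) : distF ν r ≤ 1 := by
  haveI := h.1
  exact measureReal_le_one

lemma distF_mono {ν : Measure ℝ} (h : MemM ν) : Monotone (distF ν) := by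
  haveI := h.1
  intro a b hab
  exact measureReal_mono (Icc_subset_Icc_right hab)

lemma distF_pos {ν : Measure ℝ} (h : MemM ν) (h0 : ν {0} ≠ 0) {r : ℝ} (hr : 0 ≤ r) :
    0 < distF ν r := by
  haveI := h.1
  refine ENNReal.toReal_pos (fun h1 => h0 ?_) (measure_ne_top _ _)
  refine measure_mono_null ?_ h1
  intro y hy
  rw [mem_singleton_iff] at hy
  subst hy
  exact ⟨le_rfl, hr⟩

def atomsAfter (ν : Measure ℝ) (s : ℝ) : Set ℝ := {q : ℝ | s < q ∧ q ≤ 1 ∧ ν {q} ≠ 0}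

lemma atomsAfter_finite {ν : Measure ℝ} (hf : FinSupp ν) (s : ℝ) : (atomsAfter ν s).Finite := by
  obtain ⟨S, hS⟩ := hf
  refine S.finite_toSet.subset ?_
  rintro q ⟨-, -, hq⟩
  by_contra hqS
  exact hq (measure_mono_null (singleton_subset_iff.2 hqS) hS)

lemma nextPt_mem {ν : Measure ℝ} (hf : FinSupp ν) (s : ℝ) :
    nextPt ν s ∈ atomsAfter ν s ∪ {1} :=
  Set.Nonempty.csInf_mem ⟨1, Or.inr rfl⟩ ((atomsAfter_finite hf s).union (finite_singleton 1))

lemma nextPt_le {ν : Measure ℝ} (hf : FinSupp ν) {s q : ℝ} (hq : q ∈ atomsAfter ν s ∪ {1}) :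
    nextPt ν s ≤ q :=
  csInf_le ((atomsAfter_finite hf s).union (finite_singleton 1)).bddBelow hq

lemma atomic_nice {β : ℕ → ℝ} {ν : Measure ℝ} {Φ : ℝ → ℝ → ℝ}
    (hν : MemM ν) (hf : FinSupp ν) (h0 : ν {0} ≠ 0) (hs : IsAtomicSol β ν Φ) :
    ∀ r ∈ Icc (0 : ℝ) 1, Nice (Φ r) := by
  have key : ∀ n : ℕ, ∀ r ∈ Icc (0 : ℝ) 1, (atomsAfter ν r).ncard ≤ n → Nice (Φ r) := by
    have h1 : Nice (Φ 1) := by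
      have : Φ 1 = fun x => Real.log (Real.cosh x) := funext hs.1
      rw [this]; exact Nice.log_cosh
    have step : ∀ r ∈ Ico (0 : ℝ) 1, Nice (Φ (nextPt ν r)) → Nice (Φ r) := by
      intro r hr hN
      have : Φ r = fun x => opG (distF ν r) √(xiD β (nextPt ν r) - xiD β r) (Φ (nextPt ν r)) x := by
        funext x
        rw [hs.2 r hr x, gStep_eq _ _ (distF_pos hν h0 hr.1)]
      rw [this]
      exact hN.opG_nice (distF_pos hν h0 hr.1) (distF_le_one hν r) _
    intro n
    induction n with
    | zero =>
      intro r hr hn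
      rcases hr.2.eq_or_lt with rfl | hr1
      · exact h1
      refine step r ⟨hr.1, hr1⟩ ?_
      have he : atomsAfter ν r = ∅ := by
        rw [← Set.ncard_eq_zero (atomsAfter_finite hf r)]; omega
      have := nextPt_mem hf r
      rw [he, empty_union, mem_singleton_iff] at this
      rw [this]; exact h1
    | succ n ih =>
      intro r hr hn
      rcases hr.2.eq_or_lt with rfl | hr1
      · exact h1
      refine step r ⟨hr.1, hr1⟩ ?_
      rcases nextPt_mem hf r with hm | hm
      · refine ih _ ⟨hr.1.trans hm.1.le, hm.2.1⟩ ?_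
        have : (atomsAfter ν (nextPt ν r)).ncard < (atomsAfter ν r).ncard := by
          refine Set.ncard_lt_ncard ?_ (atomsAfter_finite hf r)
          refine ⟨fun q hq => ⟨hm.1.trans hq.1, hq.2⟩, fun h => ?_⟩
          exact lt_irrefl _ (h hm).1
        omega
      · rw [mem_singleton_iff] at hm
        rw [hm]; exact h1
  intro r hr
  exact key _ r hr le_rfl

lemma distF_const {ν : Measure ℝ} (hν : MemM ν) (hf : FinSupp ν) {s t : ℝ} (hst : s ≤ t)
    (hs : 0 ≤ s) (hno : ∀ q ∈ Ioc s t, ν {q} = 0) : distF ν t = distF ν s := by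
  haveI := hν.1
  have h1 : ν (Ioc s t) = 0 := by
    obtain ⟨S, hS⟩ := hf
    have hsub : Ioc s t ⊆ (S : Set ℝ)ᶜ ∪ ⋃ q ∈ (S : Set ℝ) ∩ Ioc s t, {q} := by
      intro y hy
      by_cases hyS : y ∈ (S : Set ℝ)
      · right
        simp only [mem_iUnion]
        exact ⟨y, ⟨hyS, hy⟩, rfl⟩
      · exact Or.inl hyS
    refine measure_mono_null hsub (measure_union_null hS ?_)
    refine (measure_biUnion_null_iff ((S.countable_toSet).mono inter_subset_left)).2 ?_
    intro q hq
    exact hno q hq.2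
  unfold distF
  congr 1
  rw [← Icc_union_Ioc_eq_Icc hs hst]
  refine le_antisymm ((measure_union_le _ _).trans (by rw [h1, add_zero])) (measure_mono subset_union_left)

lemma one_step {β : ℕ → ℝ} (hβ : ValidBeta β) {ν : Measure ℝ} {Φ : ℝ → ℝ → ℝ}
    (hν : MemM ν) (hf : FinSupp ν) (h0 : ν {0} ≠ 0) (hΦ : IsAtomicSol β ν Φ)
    {s t : ℝ} (hs : 0 ≤ s) (hst : s < t) (ht : t ≤ 1) (hno : ∀ q ∈ Ioo s t, ν {q} = 0) (x : ℝ) :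
    Φ s x = opG (distF ν s) √(xiD β t - xiD β s) (Φ t) x := by
  have hg : ∀ r ∈ Ico (0 : ℝ) 1, ∀ x,
      Φ r x = opG (distF ν r) √(xiD β (nextPt ν r) - xiD β r) (Φ (nextPt ν r)) x := by
    intro r hr x
    rw [hΦ.2 r hr x, gStep_eq _ _ (distF_pos hν h0 hr.1)]
  have hs1 := hg s ⟨hs, hst.trans_le ht⟩ x
  have hp := nextPt_mem hf s
  have htp : t ≤ nextPt ν s := by
    rcases hp with hp | hp
    · by_contra hlt
      exact hp.2.2 (hno _ ⟨hp.1, not_le.1 hlt⟩)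
    · rw [mem_singleton_iff] at hp; rwa [hp]
  have hp1 : nextPt ν s ≤ 1 := nextPt_le hf (Or.inr rfl)
  rcases htp.eq_or_lt with he | hlt
  · rw [← he] at hs1; exact hs1
  have htat : ν {t} = 0 := by
    by_contra hne
    exact absurd (nextPt_le hf (Or.inl ⟨hst, ht, hne⟩)) (not_le.2 hlt)
  have hset : atomsAfter ν t = atomsAfter ν s := by
    ext q
    constructor
    · rintro ⟨h1, h2⟩; exact ⟨hst.trans h1, h2⟩
    · rintro ⟨h1, h2, h3⟩
      refine ⟨?_, h2, h3⟩
      by_contra hle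
      rcases (not_lt.1 hle).eq_or_lt with h | h
      · exact h3 (h ▸ htat)
      · exact h3 (hno q ⟨h1, h⟩)
  have hnp : nextPt ν t = nextPt ν s := by
    change sInf (atomsAfter ν t ∪ {1}) = sInf (atomsAfter ν s ∪ {1})
    rw [hset]
  have hd : distF ν t = distF ν s := by
    refine distF_const hν hf hst.le hs fun q hq => ?_
    rcases hq.2.eq_or_lt with h | h
    · rw [h]; exact htat
    · exact hno q ⟨hq.1, h⟩
  have ht1 : Φ t = fun y => opG (distF ν s) √(xiD β (nextPt ν s) - xiD β t) (Φ (nextPt ν s)) y := by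
    funext y
    rw [hg t ⟨hs.trans hst.le, hlt.trans_le hp1⟩ y, hnp, hd]
  have hN := atomic_nice hν hf h0 hΦ (nextPt ν s) ⟨(hs.trans hst.le).trans htp, hp1⟩
  rw [hs1, ht1]
  have hv : 0 ≤ xiD β t - xiD β s := sub_nonneg.2 (xiD_mono hβ hs hst.le ht)
  have hw : 0 ≤ xiD β (nextPt ν s) - xiD β t :=
    sub_nonneg.2 (xiD_mono hβ (hs.trans hst.le) htp hp1)
  have := hN.opG_comp (distF_pos hν h0 hs) hv hw x
  rw [show xiD β t - xiD β s + (xiD β (nextPt ν s) - xiD β t) = xiD β (nextPt ν s) - xiD β s by ring]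
    at this
  exact this.symm

end

section
open scoped Topology

def stp (s t : ℝ) (n : ℕ) : ℝ := (t - s) / ((n : ℝ) + 1)
def pt (s t : ℝ) (n k : ℕ) : ℝ := s + k * stp s t n
def roundUp (s t : ℝ) (n : ℕ) (q : ℝ) : ℝ := min 1 (s + (⌈(q - s) / stp s t n⌉ : ℝ) * stp s t n)
def epn (n : ℕ) : ℝ := 1 / ((n : ℝ) + 1)
def nuN (μ : Measure ℝ) (s t : ℝ) (n : ℕ) : Measure ℝ :=
  ENNReal.ofReal (1 - epn n) • Measure.map (roundUp s t n) μ
    + ENNReal.ofReal (epn n) • Measure.dirac 0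

section
variable {s t : ℝ} {n : ℕ}

lemma epn_pos (n : ℕ) : 0 < epn n := by unfold epn; positivity
lemma epn_le (n : ℕ) : epn n ≤ 1 := by
  unfold epn
  rw [div_le_one (by positivity)]
  have : (0 : ℝ) ≤ n := Nat.cast_nonneg n
  linarith
lemma epn_tendsto : Tendsto epn atTop (𝓝 0) := tendsto_one_div_add_atTop_nhds_zero_nat

lemma stp_pos (hst : s < t) (n : ℕ) : 0 < stp s t n := by
  unfold stp
  have : 0 < t - s := sub_pos.2 hst
  positivity

lemma stp_eq (s t : ℝ) (n : ℕ) : stp s t n = (t - s) * epn n := by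
  unfold stp epn; ring

lemma stp_tendsto (s t : ℝ) : Tendsto (stp s t) atTop (𝓝 0) := by
  have := epn_tendsto.const_mul (t - s)
  rw [mul_zero] at this
  exact this.congr fun n => (stp_eq s t n).symm

lemma pt_zero (s t : ℝ) (n : ℕ) : pt s t n 0 = s := by simp [pt]
lemma pt_last (s t : ℝ) (n : ℕ) : pt s t n (n + 1) = t := by
  unfold pt stp
  have : (n : ℝ) + 1 ≠ 0 := by positivity
  push_cast
  field_simp
  ring
lemma pt_succ (s t : ℝ) (n k : ℕ) : pt s t n (k + 1) = pt s t n k + stp s t n := by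
  unfold pt; push_cast; ring
lemma pt_mono (hst : s < t) (n : ℕ) : StrictMono (pt s t n) := by
  refine strictMono_nat_of_lt_succ fun k => ?_
  rw [pt_succ]; linarith [stp_pos hst n]
lemma pt_mem (hst : s < t) {n k : ℕ} (hk : k ≤ n + 1) : pt s t n k ∈ Icc s t := by
  constructor
  · have := (pt_mono hst n).monotone (Nat.zero_le k)
    rwa [pt_zero] at this
  · have := (pt_mono hst n).monotone hk
    rwa [pt_last] at this

lemma le_roundUp (hst : s < t) {q : ℝ} (hq : q ≤ 1) : q ≤ roundUp s t n q := by
  refine le_min hq ?_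
  have h := stp_pos hst n
  have h1 := Int.le_ceil ((q - s) / stp s t n)
  rw [div_le_iff₀ h] at h1
  linarith

lemma roundUp_le (hst : s < t) (q : ℝ) : roundUp s t n q ≤ q + stp s t n := by
  refine (min_le_right _ _).trans ?_
  have h := stp_pos hst n
  have h1 := (Int.ceil_lt_add_one ((q - s) / stp s t n)).le
  have h2 := mul_le_mul_of_nonneg_right h1 h.le
  rw [add_mul, div_mul_cancel₀ _ h.ne'] at h2
  linarith

lemma roundUp_meas (s t : ℝ) (n : ℕ) : Measurable (roundUp s t n) := by
  unfold roundUp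
  refine measurable_const.min (measurable_const.add (Measurable.mul_const ?_ _))
  exact (measurable_from_top (f := fun z : ℤ => (z : ℝ))).comp
    (Measurable.ceil ((measurable_id.sub_const s).div_const _))

variable {μ : Measure ℝ}

lemma ae_Icc (hμ : MemM μ) : ∀ᵐ q ∂μ, q ∈ Icc (0 : ℝ) 1 := hμ.2

lemma nuN_memM (hst : s < t) (hμ : MemM μ) (n : ℕ) : MemM (nuN μ s t n) := by
  haveI := hμ.1
  haveI : IsProbabilityMeasure (Measure.map (roundUp s t n) μ) :=
    Measure.isProbabilityMeasure_map (roundUp_meas s t n).aemeasurable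
  constructor
  · constructor
    simp only [nuN, Measure.add_apply, Measure.smul_apply, measure_univ, smul_eq_mul, mul_one]
    rw [← ENNReal.ofReal_add (by linarith [epn_le n]) (epn_pos n).le]
    simp
  · simp only [nuN, Measure.add_apply, Measure.smul_apply, smul_eq_mul]
    have h1 : Measure.map (roundUp s t n) μ (Icc 0 1)ᶜ = 0 := by
      rw [Measure.map_apply (roundUp_meas s t n) measurableSet_Icc.compl]
      refine measure_mono_null ?_ hμ.2
      intro q hq hq2
      exact hq ⟨hq2.1.trans (le_roundUp hst hq2.2), min_le_left _ _⟩
    have h2 : Measure.dirac (0 : ℝ) (Icc (0 : ℝ) 1)ᶜ = 0 := by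
      rw [Measure.dirac_apply' _ measurableSet_Icc.compl]
      simp
    rw [h1, h2]; simp

lemma nuN_finSupp (hst : s < t) (hμ : MemM μ) (n : ℕ) : FinSupp (nuN μ s t n) := by
  haveI := hμ.1
  classical
  set S : Finset ℝ := ((Finset.Icc ⌈(0 - s) / stp s t n⌉ ⌈(1 - s) / stp s t n⌉).image
    fun j : ℤ => min 1 (s + (j : ℝ) * stp s t n)) ∪ {0} with hS
  refine ⟨S, ?_⟩
  simp only [nuN, Measure.add_apply, Measure.smul_apply, smul_eq_mul]
  have hm : MeasurableSet ((S : Set ℝ)ᶜ) := S.measurableSet.compl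
  have h1 : Measure.map (roundUp s t n) μ (S : Set ℝ)ᶜ = 0 := by
    rw [Measure.map_apply (roundUp_meas s t n) hm]
    refine measure_mono_null ?_ hμ.2
    intro q hq hq2
    refine hq ?_
    have h := stp_pos hst n
    rw [hS]
    push_cast
    left
    refine ⟨⌈(q - s) / stp s t n⌉, ⟨?_, ?_⟩, rfl⟩
    · apply Int.ceil_le_ceil; gcongr; exact hq2.1
    · apply Int.ceil_le_ceil; gcongr; exact hq2.2
  have h2 : Measure.dirac (0 : ℝ) (S : Set ℝ)ᶜ = 0 := by
    rw [Measure.dirac_apply' _ hm]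
    simp [hS]
  rw [h1, h2]; simp

lemma nuN_zero (μ : Measure ℝ) (s t : ℝ) (n : ℕ) : nuN μ s t n {0} ≠ 0 := by
  simp only [nuN, Measure.add_apply, Measure.smul_apply, smul_eq_mul]
  have := epn_pos n
  simp [this]

lemma nuN_no_atom (hs : 0 ≤ s) (hst : s < t) (ht : t ≤ 1) {n k : ℕ} (hk : k ≤ n)
    (μ : Measure ℝ) : ∀ q ∈ Ioo (pt s t n k) (pt s t n (k + 1)), nuN μ s t n {q} = 0 := by
  intro q hq
  have hq1 := pt_mem hst (show k ≤ n + 1 by omega)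
  have hq2 := pt_mem hst (show k + 1 ≤ n + 1 by omega)
  have h := stp_pos hst n
  simp only [nuN, Measure.add_apply, Measure.smul_apply, smul_eq_mul]
  have h1 : Measure.map (roundUp s t n) μ {q} = 0 := by
    rw [Measure.map_apply (roundUp_meas s t n) (measurableSet_singleton q)]
    convert measure_empty (μ := μ)
    rw [eq_empty_iff_forall_notMem]
    intro y hy
    have hy : roundUp s t n y = q := hy
    unfold roundUp at hy
    rcases min_choice 1 (s + (⌈(y - s) / stp s t n⌉ : ℝ) * stp s t n) with h1 | h1
    · rw [h1] at hy
      linarith [hq.2, hq2.2]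
    · rw [h1] at hy
      rw [← hy] at hq
      unfold pt at hq
      obtain ⟨ha, hb⟩ := hq
      rw [add_lt_add_iff_left, mul_lt_mul_iff_left₀ h] at ha hb
      have ha' : ((k : ℤ) : ℝ) < (⌈(y - s) / stp s t n⌉ : ℝ) := by exact_mod_cast ha
      have hb' : (⌈(y - s) / stp s t n⌉ : ℝ) < (((k : ℤ) + 1 : ℤ) : ℝ) := by
        push_cast at hb ⊢; exact hb
      rw [Int.cast_lt] at ha' hb'
      omega
  have h2 : Measure.dirac (0 : ℝ) {q} = 0 := by
    rw [Measure.dirac_apply' _ (measurableSet_singleton q)]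
    have : (0 : ℝ) ≠ q := by have := hq.1; have := hq1.1; intro h; linarith
    simp [this]
  rw [h1, h2]; simp

lemma nuN_const (hs : 0 ≤ s) (hst : s < t) (ht : t ≤ 1) (hμ : MemM μ) {n k : ℕ} (hk : k ≤ n)
    {r : ℝ} (hr : r ∈ Ico (pt s t n k) (pt s t n (k + 1))) :
    distF (nuN μ s t n) r = distF (nuN μ s t n) (pt s t n k) := by
  refine distF_const (nuN_memM hst hμ n) (nuN_finSupp hst hμ n) hr.1
    (hs.trans (pt_mem hst (show k ≤ n + 1 by omega)).1) fun q hq => ?_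
  exact nuN_no_atom hs hst ht hk μ q ⟨hq.1, hq.2.trans_lt hr.2⟩

lemma nuN_distF (hst : s < t) (hμ : MemM μ) (n : ℕ) {r : ℝ} (hr : r ∈ Icc (0 : ℝ) 1) :
    |distF (nuN μ s t n) r - distF μ r| ≤ distF μ r - distF μ (r - stp s t n) + epn n := by
  haveI := hμ.1
  have hmeas := roundUp_meas s t n
  set b := μ.real (roundUp s t n ⁻¹' Icc 0 r) with hb
  have he : distF (nuN μ s t n) r = (1 - epn n) * b + epn n := by
    unfold distF nuN
    haveI : IsProbabilityMeasure (Measure.map (roundUp s t n) μ) :=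
      Measure.isProbabilityMeasure_map hmeas.aemeasurable
    rw [Measure.add_apply, Measure.smul_apply, Measure.smul_apply, smul_eq_mul, smul_eq_mul,
      Measure.map_apply hmeas measurableSet_Icc, Measure.dirac_apply' _ measurableSet_Icc,
      ENNReal.toReal_add (ENNReal.mul_ne_top ENNReal.ofReal_ne_top (measure_ne_top _ _))
        (by simp [hr.1]), ENNReal.toReal_mul, ENNReal.toReal_ofReal (by linarith [epn_le n])]
    simp [hr.1, (epn_pos n).le, hb, Measure.real]
  have hb1 : b ≤ distF μ r := by
    refine ENNReal.toReal_mono (measure_ne_top _ _) (measure_mono_ae ?_)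
    filter_upwards [ae_Icc hμ] with q hq hq2
    exact ⟨hq.1, (le_roundUp hst hq.2).trans hq2.2⟩
  have hb2 : distF μ (r - stp s t n) ≤ b := by
    refine ENNReal.toReal_mono (measure_ne_top _ _) (measure_mono_ae ?_)
    filter_upwards [ae_Icc hμ] with q hq hq2
    refine ⟨hq.1.trans (le_roundUp hst hq.2), (roundUp_le hst q).trans ?_⟩
    have : q ≤ r - stp s t n := hq2.2
    linarith
  have hb3 : b ≤ 1 := hb1.trans (distF_le_one hμ r)
  have hb0 : 0 ≤ b := measureReal_nonneg
  have h1 := epn_pos n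
  rw [he, abs_le]
  constructor <;> nlinarith

lemma nuN_tendsto (hst : s < t) (hμ : MemM μ) : ∀ᵐ r : ℝ, r ∈ Icc (0 : ℝ) 1 →
    Tendsto (fun n => distF (nuN μ s t n) r) atTop (𝓝 (distF μ r)) := by
  have hc := (distF_mono hμ).countable_not_continuousAt
  filter_upwards [hc.ae_notMem volume] with r hr hr1
  have hcont : ContinuousAt (distF μ) r := by
    by_contra h; exact hr h
  have h1 : Tendsto (fun n => distF μ (r - stp s t n)) atTop (𝓝 (distF μ r)) := by
    refine hcont.tendsto.comp ?_
    have := (stp_tendsto s t).const_sub r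
    rwa [sub_zero] at this
  have h2 : Tendsto (fun n => distF μ r - distF μ (r - stp s t n) + epn n) atTop (𝓝 0) := by
    have := (h1.const_sub (distF μ r)).add epn_tendsto
    simpa using this
  rw [tendsto_iff_norm_sub_tendsto_zero]
  exact squeeze_zero (fun _ => norm_nonneg _) (fun n => nuN_distF hst hμ n hr1) h2

lemma distF_meas (hμ : MemM μ) : Measurable (distF μ) := (distF_mono hμ).measurable

lemma dM_tendsto (hst : s < t) (hμ : MemM μ) :
    Tendsto (fun n => dM μ (nuN μ s t n)) atTop (𝓝 0) := by
  suffices h : Tendsto (fun n => dM μ (nuN μ s t n)) atTop (𝓝 (∫ r in (0 : ℝ)..1, (0 : ℝ))) by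
    simpa using h
  unfold dM
  refine intervalIntegral.tendsto_integral_filter_of_dominated_convergence (fun _ => 1) ?_ ?_ ?_ ?_
  · refine Eventually.of_forall fun n => Measurable.aestronglyMeasurable ?_
    exact ((distF_meas hμ).sub (distF_meas (nuN_memM hst hμ n))).abs
  · refine Eventually.of_forall fun n => Eventually.of_forall fun r _ => ?_
    rw [Real.norm_eq_abs, abs_abs, abs_le]
    have h1 := distF_nonneg μ r
    have h2 := distF_nonneg (nuN μ s t n) r
    have h3 := distF_le_one hμ r
    have h4 := distF_le_one (nuN_memM hst hμ n) r
    constructor <;> linarith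
  · simp
  · filter_upwards [nuN_tendsto hst hμ] with r hr hr1
    rw [uIoc_of_le zero_le_one] at hr1
    have := ((hr ⟨hr1.1.le, hr1.2⟩).const_sub (distF μ r)).abs
    simpa using this

variable {β : ℕ → ℝ} {Φ : Measure ℝ → ℝ → ℝ → ℝ}

lemma nuN_nice (hst : s < t) (hμ : MemM μ) (hΦ : IsParisiFamily β Φ) (n : ℕ) :
    ∀ r ∈ Icc (0 : ℝ) 1, Nice (Φ (nuN μ s t n) r) :=
  atomic_nice (nuN_memM hst hμ n) (nuN_finSupp hst hμ n) (nuN_zero μ s t n)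
    (hΦ.1 _ (nuN_memM hst hμ n) (nuN_finSupp hst hμ n))

lemma phi_unif (hst : s < t) (hμ : MemM μ) (hΦ : IsParisiFamily β Φ) {ε : ℝ} (hε : 0 < ε) :
    ∀ᶠ n in atTop, ∀ r ∈ Icc (0 : ℝ) 1, ∀ x, |Φ (nuN μ s t n) r x - Φ μ r x| < ε := by
  obtain ⟨δ, hδ, h⟩ := hΦ.2 μ hμ ε hε
  filter_upwards [(dM_tendsto hst hμ).eventually (gt_mem_nhds hδ)] with n hn r hr x
  rw [abs_sub_comm]
  exact h _ (nuN_memM hst hμ n) hn r hr x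

lemma phi_tendsto (hst : s < t) (hμ : MemM μ) (hΦ : IsParisiFamily β Φ) {r : ℝ}
    (hr : r ∈ Icc (0 : ℝ) 1) (x : ℝ) :
    Tendsto (fun n => Φ (nuN μ s t n) r x) atTop (𝓝 (Φ μ r x)) := by
  rw [Metric.tendsto_nhds]
  intro ε hε
  filter_upwards [phi_unif hst hμ hΦ hε] with n hn
  exact hn r hr x

lemma phi_nice (hμ : MemM μ) (hΦ : IsParisiFamily β Φ) {r : ℝ}
    (hr : r ∈ Icc (0 : ℝ) 1) : Nice (Φ μ r) :=
  Nice.of_tendsto (fun n => nuN_nice zero_lt_one hμ hΦ n r hr)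
    (fun x => phi_tendsto zero_lt_one hμ hΦ hr x)

lemma phi_step (hβ : ValidBeta β) (hs : 0 ≤ s) (hst : s < t) (ht : t ≤ 1) (hμ : MemM μ)
    (hΦ : IsParisiFamily β Φ) {n k : ℕ} (hk : k ≤ n) (x : ℝ) :
    Φ (nuN μ s t n) (pt s t n k) x = opG (distF (nuN μ s t n) (pt s t n k))
      √(xiD β (pt s t n (k + 1)) - xiD β (pt s t n k)) (Φ (nuN μ s t n) (pt s t n (k + 1))) x :=
  one_step hβ (nuN_memM hst hμ n) (nuN_finSupp hst hμ n) (nuN_zero μ s t n)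
    (hΦ.1 _ (nuN_memM hst hμ n) (nuN_finSupp hst hμ n))
    (hs.trans (pt_mem hst (show k ≤ n + 1 by omega)).1) (pt_mono hst n (Nat.lt_succ_self k))
    ((pt_mem hst (show k + 1 ≤ n + 1 by omega)).2.trans ht) (nuN_no_atom hs hst ht hk μ) x

/-- Time regularity within a cell. -/
lemma phi_cell (hβ : ValidBeta β) (hs : 0 ≤ s) (hst : s < t) (ht : t ≤ 1) (hμ : MemM μ)
    (hΦ : IsParisiFamily β Φ) {n k : ℕ} (hk : k ≤ n) {r : ℝ}
    (hr : r ∈ Ico (pt s t n k) (pt s t n (k + 1))) (x : ℝ) :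
    Φ (nuN μ s t n) r x = opG (distF (nuN μ s t n) (pt s t n k))
      √(xiD β (pt s t n (k + 1)) - xiD β r) (Φ (nuN μ s t n) (pt s t n (k + 1))) x := by
  rw [← nuN_const hs hst ht hμ hk hr]
  exact one_step hβ (nuN_memM hst hμ n) (nuN_finSupp hst hμ n) (nuN_zero μ s t n)
    (hΦ.1 _ (nuN_memM hst hμ n) (nuN_finSupp hst hμ n))
    ((hs.trans (pt_mem hst (show k ≤ n + 1 by omega)).1).trans hr.1) hr.2
    ((pt_mem hst (show k + 1 ≤ n + 1 by omega)).2.trans ht)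
    (fun q hq => nuN_no_atom hs hst ht hk μ q ⟨hr.1.trans_lt hq.1, hq.2⟩) x
end

end

section
open scoped Topology

section
variable {Ω : Type*} [mΩ : MeasurableSpace Ω] {P : Measure Ω} [IsProbabilityMeasure P]

lemma lip_cont {g : ℝ → ℝ} (hg : ∀ x y, |g x - g y| ≤ |x - y|) : Continuous g := by
  have : LipschitzWith 1 g := LipschitzWith.of_dist_le_mul fun x y => by
    simpa [Real.dist_eq] using hg x y
  exact this.continuous

lemma lip_growth {g : ℝ → ℝ} (hg : ∀ x y, |g x - g y| ≤ |x - y|) (y : ℝ) : |g y| ≤ |g 0| + |y| := by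
  have h1 := hg y 0
  have h2 : |g y| ≤ |g 0| + |g y - g 0| := by
    have := abs_add_le (g 0) (g y - g 0)
    rwa [add_sub_cancel] at this
  rw [sub_zero] at h1
  linarith

lemma lip_integrable {g : ℝ → ℝ} (hg : ∀ x y, |g x - g y| ≤ |x - y|) {Y : Ω → ℝ}
    (hY : Integrable Y P) : Integrable (fun ω => g (Y ω)) P := by
  refine Integrable.mono' ((integrable_const |g 0|).add hY.abs)
    ((lip_cont hg).comp_aestronglyMeasurable hY.aestronglyMeasurable)
    (Eventually.of_forall fun ω => ?_)
  exact lip_growth hg (Y ω)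

lemma gavg_lip {f : ℝ → ℝ} (hf : Nice f) (σ : ℝ) (x y : ℝ) :
    |(∫ z, f (x + z * σ) ∂stdG) - ∫ z, f (y + z * σ) ∂stdG| ≤ |x - y| := by
  rw [← integral_sub (hf.int _ _) (hf.int _ _)]
  have h := norm_integral_le_of_norm_le_const (μ := stdG)
    (f := fun z => f (x + z * σ) - f (y + z * σ)) (C := |x - y|)
    (Eventually.of_forall fun z => by
      have := hf.lip (x + z * σ) (y + z * σ)
      rwa [add_sub_add_right_eq_sub] at this)
  rwa [probReal_univ, mul_one] at h

lemma gauss_incr_integrable {D : Ω → ℝ} (hD : Measurable D) {δ : ℝ}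
    (hmap : Measure.map D P = gaussianReal 0 (Real.toNNReal δ)) : Integrable D P := by
  have h : Integrable (fun z : ℝ => z) (Measure.map D P) := by
    rw [hmap]
    exact memLp_one_iff_integrable.1 (memLp_id_gaussianReal 1)
  exact h.comp_measurable hD

end

section
lemma indep_expect {Ω : Type*} {𝓖 : MeasurableSpace Ω} [mΩ : MeasurableSpace Ω] {P : Measure Ω}
    [IsProbabilityMeasure P] {f : ℝ → ℝ} (hf : Nice f) (h𝓖 : 𝓖 ≤ mΩ)
    {Y D : Ω → ℝ} (hY : Measurable[𝓖] Y) (hYi : Integrable Y P) (hD : Measurable D)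
    {δ : ℝ} (hδ : 0 ≤ δ) (hmap : Measure.map D P = gaussianReal 0 (Real.toNNReal δ))
    (hind : Indep (MeasurableSpace.comap D inferInstance) 𝓖 P) :
    ∫ ω, f (Y ω + D ω) ∂P = ∫ ω, (∫ z, f (Y ω + z * √δ) ∂stdG) ∂P := by
  have hYm : Measurable Y := hY.mono h𝓖 le_rfl
  have hif : IndepFun Y D P := by
    rw [IndepFun_iff_Indep]
    exact (indep_of_indep_of_le_right hind hY.comap_le).symm
  have hp := (indepFun_iff_map_prod_eq_prod_map_map hYm.aemeasurable hD.aemeasurable).1 hif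
  have hDi := gauss_incr_integrable hD hmap
  haveI : IsProbabilityMeasure (Measure.map Y P) :=
    Measure.isProbabilityMeasure_map hYm.aemeasurable
  have hcf := hf.cont
  have hc2 : Continuous fun p : ℝ × ℝ => f (p.1 + p.2) := by fun_prop
  have hIntg : Integrable (fun p : ℝ × ℝ => f (p.1 + p.2))
      ((Measure.map Y P).prod (gaussianReal 0 (Real.toNNReal δ))) := by
    rw [← hmap, ← hp, integrable_map_measure hc2.aestronglyMeasurable
      (hYm.prodMk hD).aemeasurable]
    exact lip_integrable hf.lip (hYi.add hDi)
  calc ∫ ω, f (Y ω + D ω) ∂P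
      = ∫ p : ℝ × ℝ, f (p.1 + p.2) ∂(Measure.map (fun ω => (Y ω, D ω)) P) := by
        rw [integral_map (hYm.prodMk hD).aemeasurable hc2.aestronglyMeasurable]
    _ = ∫ a, (∫ b, f (a + b) ∂(gaussianReal 0 (Real.toNNReal δ))) ∂(Measure.map Y P) := by
        rw [hp, hmap, integral_prod _ hIntg]
    _ = ∫ a, (∫ z, f (a + z * √δ) ∂stdG) ∂(Measure.map Y P) := by
        congr 1
        funext a
        rw [gauss_scale (F := fun b => f (a + b)) (by fun_prop) hδ]
    _ = _ := by
        rw [integral_map hYm.aemeasurable]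
        exact (lip_cont (gavg_lip hf _)).aestronglyMeasurable

end

section
variable {Ω : Type*} [mΩ : MeasurableSpace Ω] {P : Measure Ω} [IsProbabilityMeasure P]
variable {G : ℕ → MeasurableSpace Ω} {N : ℕ} {f : ℕ → ℝ → ℝ} {m δ : ℕ → ℝ}
  {D U X : ℕ → Ω → ℝ} {x : ℝ}

/-- data of a discrete-time controlled chain -/
structure Chain (P : Measure Ω) (G : ℕ → MeasurableSpace Ω) (N : ℕ) (f : ℕ → ℝ → ℝ)
    (m δ : ℕ → ℝ) (D U X : ℕ → Ω → ℝ) (x : ℝ) : Prop where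
  hG : ∀ k ≤ N, G k ≤ mΩ
  hGm : ∀ k < N, G k ≤ G (k + 1)
  hf : ∀ k ≤ N, Nice (f k)
  hm : ∀ k < N, 0 < m k
  hm1 : ∀ k < N, m k ≤ 1
  hδ : ∀ k < N, 0 ≤ δ k
  hrec : ∀ k < N, ∀ y, f k y = opG (m k) √(δ k) (f (k + 1)) y
  hD : ∀ k < N, Measurable[G (k + 1)] (D k)
  hmap : ∀ k < N, Measure.map (D k) P = gaussianReal 0 (Real.toNNReal (δ k))
  hind : ∀ k < N, Indep (MeasurableSpace.comap (D k) inferInstance) (G k) P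
  hX0 : ∀ ω, X 0 ω = x
  hX : ∀ k < N, ∀ ω, X (k + 1) ω = X k ω + m k * δ k * U k ω + D k ω
  hU : ∀ k < N, Measurable[G k] (X k) → Measurable[G k] (U k)
  hU1 : ∀ k < N, ∀ ω, |U k ω| ≤ 1

namespace Chain

lemma meas_int (h : Chain P G N f m δ D U X x) : ∀ k ≤ N, Measurable[G k] (X k) ∧ Integrable (X k) P := by
  intro k
  induction k with
  | zero =>
    intro _
    have : X 0 = fun _ => x := funext h.hX0
    rw [this]
    exact ⟨measurable_const, integrable_const _⟩
  | succ k ih =>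
    intro hk
    obtain ⟨h1, h2⟩ := ih (by omega)
    have hU := h.hU k hk h1
    have hUm : Measurable (U k) := hU.mono (h.hG k (by omega)) le_rfl
    have hUi : Integrable (U k) P := Integrable.of_bound hUm.aestronglyMeasurable 1
      (Eventually.of_forall fun ω => h.hU1 k hk ω)
    have hDm : Measurable (D k) := (h.hD k hk).mono (h.hG (k + 1) hk) le_rfl
    have : X (k + 1) = fun ω => X k ω + m k * δ k * U k ω + D k ω := funext (h.hX k hk)
    rw [this]
    refine ⟨?_, (h2.add (hUi.const_mul _)).add (gauss_incr_integrable hDm (h.hmap k hk))⟩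
    exact ((h1.mono (h.hGm k hk) le_rfl).add
      ((hU.mono (h.hGm k hk) le_rfl).const_mul (m k * δ k))).add (h.hD k hk)

lemma U_meas (h : Chain P G N f m δ D U X x) {k : ℕ} (hk : k < N) : Measurable (U k) :=
  (h.hU k hk (h.meas_int k hk.le).1).mono (h.hG k hk.le) le_rfl

lemma Usq_int (h : Chain P G N f m δ D U X x) {k : ℕ} (hk : k < N) (c : ℝ) :
    Integrable (fun ω => c * U k ω ^ 2) P := by
  refine Integrable.const_mul ?_ c
  refine Integrable.of_bound ((h.U_meas hk).pow_const 2).aestronglyMeasurable 1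
    (Eventually.of_forall fun ω => ?_)
  rw [Real.norm_eq_abs, abs_pow]
  exact pow_le_one₀ (abs_nonneg _) (h.hU1 k hk ω)

lemma step_eq (h : Chain P G N f m δ D U X x) {k : ℕ} (hk : k < N) :
    ∫ ω, f (k + 1) (X (k + 1) ω) ∂P - ∫ ω, m k / 2 * δ k * U k ω ^ 2 ∂P
      = ∫ ω, ((∫ z, f (k + 1) (X k ω + m k * δ k * U k ω + z * √(δ k)) ∂stdG)
          - m k / 2 * δ k * U k ω ^ 2) ∂P ∧
    Integrable (fun ω => (∫ z, f (k + 1) (X k ω + m k * δ k * U k ω + z * √(δ k)) ∂stdG)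
          - m k / 2 * δ k * U k ω ^ 2) P := by
  obtain ⟨h1, h2⟩ := h.meas_int k hk.le
  have hU := h.hU k hk h1
  have hUi : Integrable (U k) P := Integrable.of_bound (h.U_meas hk).aestronglyMeasurable 1
      (Eventually.of_forall fun ω => h.hU1 k hk ω)
  have hDm : Measurable (D k) := (h.hD k hk).mono (h.hG (k + 1) hk) le_rfl
  have hf := h.hf (k + 1) hk
  have hYi : Integrable (fun ω => X k ω + m k * δ k * U k ω) P := h2.add (hUi.const_mul _)
  have hYm : Measurable[G k] (fun ω => X k ω + m k * δ k * U k ω) :=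
    h1.add (hU.const_mul (m k * δ k))
  have hI := lip_integrable (gavg_lip hf √(δ k)) hYi
  refine ⟨?_, hI.sub (h.Usq_int hk _)⟩
  rw [integral_sub hI (h.Usq_int hk _)]
  congr 1
  rw [← indep_expect hf (h.hG k hk.le) hYm hYi hDm (h.hδ k hk) (h.hmap k hk) (h.hind k hk)]
  simp_rw [h.hX k hk]

lemma upper (h : Chain P G N f m δ D U X x) : ∀ j ≤ N,
    ∫ ω, f j (X j ω) ∂P - ∑ k ∈ Finset.range j, ∫ ω, m k / 2 * δ k * U k ω ^ 2 ∂P ≤ f 0 x := by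
  intro j
  induction j with
  | zero => intro _; simp [h.hX0]
  | succ k ih =>
    intro hk
    have h1 := ih (by omega)
    obtain ⟨h2, h3⟩ := h.step_eq hk
    rw [Finset.sum_range_succ]
    have h4 := integral_mono h3 (lip_integrable (h.hf k (by omega)).lip (h.meas_int k (by omega)).2)
      (fun ω => by
        dsimp only
        rw [h.hrec k hk]
        exact (h.hf (k + 1) hk).upper (h.hm k hk) (h.hδ k hk) (U k ω) (X k ω))
    linarith

lemma lower (h : Chain P G N f m δ D U X x) {C : ℝ}
    (hC : ∀ (f : ℝ → ℝ), Nice f → ∀ (m : ℝ), 0 < m → m ≤ 1 → ∀ (v : ℝ), 0 ≤ v → v ≤ 1 → ∀ (x : ℝ),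
      opG m (√v) f x ≤ ∫ (z : ℝ), f (x + m * v * deriv f x + z * √v) ∂stdG
        - m / 2 * v * deriv f x ^ 2 + C * v ^ 2)
    (hδ1 : ∀ k < N, δ k ≤ 1) (hfb : ∀ k < N, ∀ ω, U k ω = deriv (f (k + 1)) (X k ω)) : ∀ j ≤ N,
    f 0 x - C * ∑ k ∈ Finset.range j, δ k ^ 2 ≤
      ∫ ω, f j (X j ω) ∂P - ∑ k ∈ Finset.range j, ∫ ω, m k / 2 * δ k * U k ω ^ 2 ∂P := by
  intro j
  induction j with
  | zero => intro _; simp [h.hX0]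
  | succ k ih =>
    intro hk
    have h1 := ih (by omega)
    obtain ⟨h2, h3⟩ := h.step_eq hk
    rw [Finset.sum_range_succ, Finset.sum_range_succ]
    have h4 := integral_mono (lip_integrable (h.hf k (by omega)).lip (h.meas_int k (by omega)).2)
      (h3.add (integrable_const (C * δ k ^ 2)))
      (fun ω => by
        dsimp only [Pi.add_apply]
        rw [h.hrec k hk, hfb k hk]
        exact hC _ (h.hf (k + 1) hk) _ (h.hm k hk) (h.hm1 k hk) _ (h.hδ k hk) (hδ1 k hk) (X k ω))
    have h5 := integral_add h3 (integrable_const (C * δ k ^ 2))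
    have h4 := h4.trans_eq h5
    simp only [integral_const, probReal_univ, smul_eq_mul, one_mul] at h4
    linarith

lemma total (h : Chain P G N f m δ D U X x) :
    ∫ ω, f N (X N ω) ∂P - ∑ k ∈ Finset.range N, ∫ ω, m k / 2 * δ k * U k ω ^ 2 ∂P
      = ∫ ω, (f N (X N ω) - 1 / 2 * ∑ k ∈ Finset.range N, m k * δ k * U k ω ^ 2) ∂P := by
  rw [← integral_finsetSum _ (fun k hk => h.Usq_int (Finset.mem_range.1 hk) _),
    ← integral_sub (lip_integrable (h.hf N le_rfl).lip (h.meas_int N le_rfl).2)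
      (integrable_finsetSum _ (fun k hk => h.Usq_int (Finset.mem_range.1 hk) _))]
  congr 1
  funext ω
  rw [Finset.mul_sum]
  congr 1
  refine Finset.sum_congr rfl fun k _ => by ring

end Chain
end

end

section
open scoped Topology

section
variable {s t : ℝ} {n : ℕ}

lemma cell_floor (hst : s < t) {n k : ℕ} {r : ℝ} (hr : r ∈ Ico (pt s t n k) (pt s t n (k + 1))) :
    ⌊(r - s) / stp s t n⌋₊ = k := by
  have h := stp_pos hst n
  obtain ⟨h1, h2⟩ := hr
  unfold pt at h1 h2
  have h0 : (0 : ℝ) ≤ k * stp s t n := by positivity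
  rw [Nat.floor_eq_iff (div_nonneg (by linarith) h.le), le_div_iff₀ h, div_lt_iff₀ h]
  push_cast at h2
  constructor <;> linarith

lemma exists_cell (hst : s < t) (n : ℕ) {r : ℝ} (hr : r ∈ Ico s t) :
    ∃ k ≤ n, r ∈ Ico (pt s t n k) (pt s t n (k + 1)) := by
  have h := stp_pos hst n
  have h0 : 0 ≤ (r - s) / stp s t n := div_nonneg (by linarith [hr.1]) h.le
  refine ⟨⌊(r - s) / stp s t n⌋₊, ?_, ?_, ?_⟩
  · have h1 : (r - s) / stp s t n < ((n + 1 : ℕ) : ℝ) := by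
      rw [div_lt_iff₀ h]
      have := pt_last s t n
      unfold pt at this
      linarith [hr.2]
    have := (Nat.floor_lt h0).2 h1
    omega
  · have := Nat.floor_le h0
    rw [le_div_iff₀ h] at this
    unfold pt; linarith
  · have := Nat.lt_floor_add_one ((r - s) / stp s t n)
    rw [div_lt_iff₀ h] at this
    unfold pt; push_cast; linarith

lemma cell_sub (hst : s < t) {n k : ℕ} (hk : k ≤ n) :
    Ico (pt s t n k) (pt s t n (k + 1)) ⊆ Ico s t := fun r hr =>
  ⟨(pt_mem hst (show k ≤ n + 1 by omega)).1.trans hr.1,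
    hr.2.trans_le (pt_mem hst (show k + 1 ≤ n + 1 by omega)).2⟩

/-- piecewise constant process -/
def pcu {Ω : Type*} (s t : ℝ) (n : ℕ) (U : ℕ → Ω → ℝ) (r : ℝ) (ω : Ω) : ℝ :=
  open Classical in if r ∈ Ico s t then U ⌊(r - s) / stp s t n⌋₊ ω else 0

lemma pcu_cell {Ω : Type*} (hst : s < t) {n k : ℕ} (hk : k ≤ n) (U : ℕ → Ω → ℝ) {r : ℝ}
    (hr : r ∈ Ico (pt s t n k) (pt s t n (k + 1))) (ω : Ω) : pcu s t n U r ω = U k ω := by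
  unfold pcu
  rw [if_pos (cell_sub hst hk hr), cell_floor hst hr]

lemma pcu_out {Ω : Type*} (U : ℕ → Ω → ℝ) {r : ℝ}
    (hr : r ∉ Ico s t) (ω : Ω) : pcu s t n U r ω = 0 := by
  unfold pcu
  rw [if_neg hr]

lemma pcu_abs {Ω : Type*} (hst : s < t) {n : ℕ} {U : ℕ → Ω → ℝ}
    (hU : ∀ k < n + 1, ∀ ω, |U k ω| ≤ 1) (r : ℝ) (ω : Ω) : |pcu s t n U r ω| ≤ 1 := by
  by_cases hr : r ∈ Ico s t
  · obtain ⟨k, hk, hr⟩ := exists_cell hst n hr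
    rw [pcu_cell hst hk U hr]
    exact hU k (by omega) ω
  · rw [pcu_out U hr]; simp

variable {μ : Measure ℝ} {β : ℕ → ℝ}

lemma cell_integral (hβ : ValidBeta β) (hs : 0 ≤ s) (hst : s < t) (ht : t ≤ 1) (hμ : MemM μ)
    {v : ℝ → ℝ} {w : ℕ → ℝ}
    (hv : ∀ k ≤ n, ∀ r ∈ Ico (pt s t n k) (pt s t n (k + 1)), v r = w k) {K : ℕ} (hK : K ≤ n + 1) :
    ∫ r in s..pt s t n K, distF (nuN μ s t n) r * zetaFn β r * v r
      = ∑ k ∈ Finset.range K, distF (nuN μ s t n) (pt s t n k)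
          * (xiD β (pt s t n (k + 1)) - xiD β (pt s t n k)) * w k := by
  have hcell : ∀ k < K, EqOn
      (fun r => distF (nuN μ s t n) (pt s t n k) * w k * zetaFn β r)
      (fun r => distF (nuN μ s t n) r * zetaFn β r * v r)
      (uIoo (pt s t n k) (pt s t n (k + 1))) := by
    intro k hk r hr
    rw [uIoo_of_le (pt_mono hst n (Nat.lt_succ_self k)).le] at hr
    have hr' : r ∈ Ico (pt s t n k) (pt s t n (k + 1)) := ⟨hr.1.le, hr.2⟩
    dsimp only
    rw [hv k (by omega) r hr', nuN_const hs hst ht hμ (by omega) hr']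
    ring
  have hmem : ∀ k ≤ n + 1, pt s t n k ∈ Icc (0 : ℝ) 1 := fun k hk =>
    ⟨hs.trans (pt_mem hst hk).1, (pt_mem hst hk).2.trans ht⟩
  have h1 := intervalIntegral.sum_integral_adjacent_intervals (a := pt s t n) (n := K)
    (f := fun r => distF (nuN μ s t n) r * zetaFn β r * v r) (μ := volume) (fun k hk =>
      ((zeta_intervalIntegrable hβ (hmem k (by omega)) (hmem (k + 1) (by omega))).const_mul _).congr_uIoo
        (hcell k hk))
  rw [pt_zero] at h1
  rw [← h1]
  refine Finset.sum_congr rfl fun k hk => ?_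
  have hk := Finset.mem_range.1 hk
  rw [← intervalIntegral.integral_congr_uIoo (hcell k hk), intervalIntegral.integral_const_mul,
    integral_zeta hβ (hmem k (by omega)).1 (pt_mono hst n (Nat.lt_succ_self k)).le
      (hmem (k + 1) (by omega)).2]
  ring

variable {Ω : Type*} [mΩ : MeasurableSpace Ω] {P : Measure Ω} [IsProbabilityMeasure P]
  {Φ : Measure ℝ → ℝ → ℝ → ℝ} {B : ℝ → Ω → ℝ} {𝓕 : Filtration ℝ mΩ} {x : ℝ}

abbrev gChain (P : Measure Ω) (β : ℕ → ℝ) (Φ : Measure ℝ → ℝ → ℝ → ℝ) (B : ℝ → Ω → ℝ)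
    (𝓕 : Filtration ℝ mΩ) (μ : Measure ℝ) (s t : ℝ) (n : ℕ) (U X : ℕ → Ω → ℝ) (x : ℝ) : Prop :=
  Chain P (fun k => 𝓕 (pt s t n k)) (n + 1) (fun k => Φ (nuN μ s t n) (pt s t n k))
    (fun k => distF (nuN μ s t n) (pt s t n k))
    (fun k => xiD β (pt s t n (k + 1)) - xiD β (pt s t n k))
    (fun k ω => B (xiD β (pt s t n (k + 1))) ω - B (xiD β (pt s t n k)) ω) U X x

lemma adapt (h𝓕 : ∀ r : ℝ, (𝓕 r : MeasurableSpace Ω)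
      = ⨆ v ∈ Icc (0 : ℝ) r, MeasurableSpace.comap (fun ω => B (xiD β v) ω) inferInstance)
    {r r' : ℝ} (hr : 0 ≤ r) (hrr : r ≤ r') : Measurable[𝓕 r'] (fun ω => B (xiD β r) ω) := by
  rw [measurable_iff_comap_le, h𝓕]
  exact le_iSup₂_of_le r ⟨hr, hrr⟩ le_rfl

lemma mkChain (hβ : ValidBeta β) (hΦ : IsParisiFamily β Φ) (hB : IsStdBM P B)
    (h𝓕 : ∀ r : ℝ, (𝓕 r : MeasurableSpace Ω)
      = ⨆ v ∈ Icc (0 : ℝ) r, MeasurableSpace.comap (fun ω => B (xiD β v) ω) inferInstance)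
    (hμ : MemM μ) (hs : 0 ≤ s) (hst : s < t) (ht : t ≤ 1) (n : ℕ) {U X : ℕ → Ω → ℝ}
    (hX0 : ∀ ω, X 0 ω = x)
    (hX : ∀ k < n + 1, ∀ ω, X (k + 1) ω = X k ω + distF (nuN μ s t n) (pt s t n k)
      * (xiD β (pt s t n (k + 1)) - xiD β (pt s t n k)) * U k ω
      + (B (xiD β (pt s t n (k + 1))) ω - B (xiD β (pt s t n k)) ω))
    (hU : ∀ k < n + 1, Measurable[𝓕 (pt s t n k)] (X k) → Measurable[𝓕 (pt s t n k)] (U k))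
    (hU1 : ∀ k < n + 1, ∀ ω, |U k ω| ≤ 1) : gChain P β Φ B 𝓕 μ s t n U X x := by
  have hmem : ∀ k ≤ n + 1, pt s t n k ∈ Icc (0 : ℝ) 1 := fun k hk =>
    ⟨hs.trans (pt_mem hst hk).1, (pt_mem hst hk).2.trans ht⟩
  have hle : ∀ k, pt s t n k ≤ pt s t n (k + 1) := fun k => (pt_mono hst n (Nat.lt_succ_self k)).le
  have hxi : ∀ k < n + 1, xiD β (pt s t n k) ≤ xiD β (pt s t n (k + 1)) := fun k hk =>
    xiD_mono hβ (hmem k (by omega)).1 (hle k) (hmem (k + 1) hk).2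
  constructor
  · intro k _; exact 𝓕.le _
  · intro k _; exact 𝓕.mono (hle k)
  · intro k hk; exact nuN_nice hst hμ hΦ n _ (hmem k hk)
  · intro k hk; exact distF_pos (nuN_memM hst hμ n) (nuN_zero μ s t n) (hmem k hk.le).1
  · intro k _; exact distF_le_one (nuN_memM hst hμ n) _
  · intro k hk; exact sub_nonneg.2 (hxi k hk)
  · intro k hk y; exact phi_step hβ hs hst ht hμ hΦ (by omega) y
  · intro k hk
    exact (adapt h𝓕 (hmem (k + 1) hk).1 le_rfl).sub (adapt h𝓕 (hmem k hk.le).1 (hle k))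
  · intro k hk
    exact hB.2.2.2.1 _ _ (xiD_nonneg β (hmem k hk.le).1) (hxi k hk)
  · intro k hk
    refine indep_of_indep_of_le_right
      (hB.2.2.2.2 _ _ (xiD_nonneg β (hmem k hk.le).1) (hxi k hk)) ?_
    rw [h𝓕]
    refine iSup₂_le fun v hv => ?_
    refine le_iSup₂_of_le (f := fun v (_ : v ∈ Icc (0 : ℝ) (xiD β (pt s t n k))) =>
      MeasurableSpace.comap (B v) inferInstance) (xiD β v) ⟨xiD_nonneg β hv.1,
        xiD_mono hβ hv.1 hv.2 (hmem k hk.le).2⟩ le_rfl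
  · exact hX0
  · exact hX
  · exact hU
  · exact hU1

lemma chain_X {U X : ℕ → Ω → ℝ} (h : gChain P β Φ B 𝓕 μ s t n U X x) (ω : Ω) : ∀ K ≤ n + 1,
    X K ω = x + ∑ k ∈ Finset.range K, distF (nuN μ s t n) (pt s t n k)
          * (xiD β (pt s t n (k + 1)) - xiD β (pt s t n k)) * U k ω
      + (B (xiD β (pt s t n K)) ω - B (xiD β s) ω) := by
  intro K
  induction K with
  | zero => intro _; simp [h.hX0, pt_zero]
  | succ k ih =>
    intro hk
    rw [h.hX k hk, ih (by omega), Finset.sum_range_succ]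
    ring

lemma chain_F (hβ : ValidBeta β) (hμ : MemM μ) (hs : 0 ≤ s) (hst : s < t) (ht : t ≤ 1)
    {U X : ℕ → Ω → ℝ} (h : gChain P β Φ B 𝓕 μ s t n U X x) :
    Ffn P β (nuN μ s t n) (Φ (nuN μ s t n)) (fun r => B (xiD β r)) s t (pcu s t n U) x
      = ∫ ω, Φ (nuN μ s t n) (pt s t n (n + 1)) (X (n + 1) ω) ∂P
        - ∑ k ∈ Finset.range (n + 1), ∫ ω, distF (nuN μ s t n) (pt s t n k) / 2
          * (xiD β (pt s t n (k + 1)) - xiD β (pt s t n k)) * U k ω ^ 2 ∂P := by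
  have ht2 := h.total
  rw [ht2]
  unfold Ffn
  congr 1
  funext ω
  have h1 := cell_integral (K := n + 1) hβ hs hst ht hμ (v := fun r => pcu s t n U r ω) (w := fun k => U k ω)
    (fun k hk r hr => pcu_cell hst hk U hr ω) le_rfl
  have h2 := cell_integral (K := n + 1) hβ hs hst ht hμ (v := fun r => pcu s t n U r ω ^ 2)
    (w := fun k => U k ω ^ 2)
    (fun k hk r hr => by rw [pcu_cell hst hk U hr ω]) le_rfl
  rw [chain_X h ω (n + 1) le_rfl]
  rw [pt_last] at h1 h2 ⊢
  rw [h1, h2]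

lemma chain_upper (hβ : ValidBeta β) (hμ : MemM μ) (hs : 0 ≤ s) (hst : s < t) (ht : t ≤ 1)
    {U X : ℕ → Ω → ℝ} (h : gChain P β Φ B 𝓕 μ s t n U X x) :
    Ffn P β (nuN μ s t n) (Φ (nuN μ s t n)) (fun r => B (xiD β r)) s t (pcu s t n U) x
      ≤ Φ (nuN μ s t n) s x := by
  rw [chain_F hβ hμ hs hst ht h]
  have := h.upper (n + 1) le_rfl
  simp only [pt_zero] at this
  exact this

lemma chain_lower (hβ : ValidBeta β) (hμ : MemM μ) (hs : 0 ≤ s) (hst : s < t) (ht : t ≤ 1)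
    {C L : ℝ} (hC0 : 0 ≤ C)
    (hC : ∀ (f : ℝ → ℝ), Nice f → ∀ (m : ℝ), 0 < m → m ≤ 1 → ∀ (v : ℝ), 0 ≤ v → v ≤ 1 → ∀ (x : ℝ),
      opG m (√v) f x ≤ ∫ (z : ℝ), f (x + m * v * deriv f x + z * √v) ∂stdG
        - m / 2 * v * deriv f x ^ 2 + C * v ^ 2)
    (hL : ∀ r ∈ Icc (0 : ℝ) 1, zetaFn β r ≤ L) (hn : L * stp s t n ≤ 1)
    {U X : ℕ → Ω → ℝ} (h : gChain P β Φ B 𝓕 μ s t n U X x)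
    (hfb : ∀ k < n + 1, ∀ ω, U k ω = deriv (Φ (nuN μ s t n) (pt s t n (k + 1))) (X k ω)) :
    Φ (nuN μ s t n) s x - C * ((t - s) * L ^ 2 * stp s t n) ≤
    Ffn P β (nuN μ s t n) (Φ (nuN μ s t n)) (fun r => B (xiD β r)) s t (pcu s t n U) x := by
  have hmem : ∀ k ≤ n + 1, pt s t n k ∈ Icc (0 : ℝ) 1 := fun k hk =>
    ⟨hs.trans (pt_mem hst hk).1, (pt_mem hst hk).2.trans ht⟩
  have hδ : ∀ k < n + 1, xiD β (pt s t n (k + 1)) - xiD β (pt s t n k) ≤ L * stp s t n := by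
    intro k hk
    have := xiD_lip hβ hL (hmem k hk.le).1 (pt_mono hst n (Nat.lt_succ_self k)).le (hmem (k + 1) hk).2
    rwa [pt_succ s t n k, add_sub_cancel_left, ← pt_succ] at this
  rw [chain_F hβ hμ hs hst ht h]
  have h1 := h.lower hC (fun k hk => (hδ k hk).trans hn) hfb (n + 1) le_rfl
  simp only [pt_zero] at h1
  refine le_trans ?_ h1
  have h2 : ∑ k ∈ Finset.range (n + 1), (xiD β (pt s t n (k + 1)) - xiD β (pt s t n k)) ^ 2
      ≤ ∑ k ∈ Finset.range (n + 1), (L * stp s t n) ^ 2 := by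
    refine Finset.sum_le_sum fun k hk => ?_
    have hk := Finset.mem_range.1 hk
    exact pow_le_pow_left₀ (h.hδ k hk) (hδ k hk) 2
  rw [Finset.sum_const, Finset.card_range, nsmul_eq_mul] at h2
  have h3 : ((n + 1 : ℕ) : ℝ) * (L * stp s t n) ^ 2 = (t - s) * L ^ 2 * stp s t n := by
    have : ((n + 1 : ℕ) : ℝ) * stp s t n = t - s := by
      have := pt_last s t n; unfold pt at this; linarith
    rw [← this]; ring
  rw [h3] at h2
  have := mul_le_mul_of_nonneg_left h2 hC0
  linarith
end

end

section
open scoped Topology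

section
variable {s t : ℝ} {n : ℕ} {μ : Measure ℝ} {β : ℕ → ℝ} {L : ℝ}

lemma zeta_aesm (hβ : ValidBeta β) (hs : 0 ≤ s) (ht : t ≤ 1) :
    AEStronglyMeasurable (zetaFn β) (volume.restrict (Ioc s t)) := by
  have h := (zeta_cont hβ).mono (show Ioc s t ⊆ Icc 0 1 from fun r hr =>
    ⟨hs.trans hr.1.le, hr.2.trans ht⟩)
  exact h.aestronglyMeasurable measurableSet_Ioc

lemma zetaInd_meas (hβ : ValidBeta β) : Measurable ((Icc (0 : ℝ) 1).indicator (zetaFn β)) := by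
  classical
  have h := ContinuousOn.measurable_piecewise (zeta_cont hβ)
    (continuous_zero (M := ℝ) (X := ℝ)).continuousOn measurableSet_Icc
  rwa [Set.piecewise_eq_indicator] at h

lemma pint_meas {Ω : Type*} [MeasurableSpace Ω] {v : ℝ → Ω → ℝ}
    (hv : Measurable (Function.uncurry v)) {a b : ℝ} (hab : a ≤ b) :
    Measurable fun ω => ∫ r in a..b, v r ω := by
  simp_rw [intervalIntegral.integral_of_le hab]
  exact (StronglyMeasurable.integral_prod_left (μ := volume.restrict (Ioc a b)) (f := v)
    hv.stronglyMeasurable).measurable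

lemma wint_meas {Ω : Type*} [MeasurableSpace Ω] (hβ : ValidBeta β) (hs : 0 ≤ s) (hst : s < t)
    (ht : t ≤ 1) {ν : Measure ℝ} (hν : MemM ν) {v : ℝ → Ω → ℝ}
    (hv : Measurable (Function.uncurry v)) :
    Measurable fun ω => ∫ r in s..t, distF ν r * zetaFn β r * v r ω := by
  have h : ∀ ω, ∫ r in s..t, distF ν r * zetaFn β r * v r ω
      = ∫ r in s..t, distF ν r * ((Icc (0 : ℝ) 1).indicator (zetaFn β) r) * v r ω := by
    intro ω
    refine intervalIntegral.integral_congr fun r hr => ?_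
    rw [uIcc_of_le hst.le] at hr
    rw [indicator_of_mem (show r ∈ Icc (0 : ℝ) 1 from ⟨hs.trans hr.1, hr.2.trans ht⟩)]
  simp_rw [h]
  refine pint_meas (v := fun r ω => distF ν r * ((Icc (0 : ℝ) 1).indicator (zetaFn β) r) * v r ω)
    ?_ hst.le
  exact (((distF_meas hν).comp measurable_fst).mul ((zetaInd_meas hβ).comp measurable_fst)).mul hv

lemma weight_le (hL : ∀ r ∈ Icc (0 : ℝ) 1, zetaFn β r ≤ L) {ν : Measure ℝ} (hν : MemM ν)
    {r : ℝ} (hr : r ∈ Icc (0 : ℝ) 1) {a : ℝ} (ha : |a| ≤ 1) :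
    |distF ν r * zetaFn β r * a| ≤ L := by
  rw [abs_mul, abs_mul, abs_of_nonneg (distF_nonneg ν r), abs_of_nonneg (zeta_nonneg β hr.1)]
  have h1 := hL r hr
  have h2 := zeta_nonneg β hr.1
  calc distF ν r * zetaFn β r * |a| ≤ 1 * L * 1 := by
        have := distF_le_one hν r
        have := distF_nonneg ν r
        have : 0 ≤ L := h2.trans h1
        gcongr
    _ = L := by ring

lemma wint_abs (hs : 0 ≤ s) (hst : s < t)
    (ht : t ≤ 1) (hL : ∀ r ∈ Icc (0 : ℝ) 1, zetaFn β r ≤ L) {ν : Measure ℝ} (hν : MemM ν)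
    {v : ℝ → ℝ} (hv : ∀ r, |v r| ≤ 1) :
    |∫ r in s..t, distF ν r * zetaFn β r * v r| ≤ L * (t - s) := by
  have := intervalIntegral.norm_integral_le_of_norm_le_const (a := s) (b := t) (C := L)
    (f := fun r => distF ν r * zetaFn β r * v r) (fun r hr => by
      rw [uIoc_of_le hst.le] at hr
      exact weight_le hL hν ⟨hs.trans hr.1.le, hr.2.trans ht⟩ (hv r))
  rwa [abs_of_pos (sub_pos.2 hst)] at this

lemma wint_tendsto (hβ : ValidBeta β) (hs : 0 ≤ s) (hst : s < t) (ht : t ≤ 1)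
    (hμ : MemM μ) {vn : ℕ → ℝ → ℝ} {v : ℝ → ℝ} (hm : ∀ n, Measurable (vn n))
    (h1 : ∀ n r, |vn n r| ≤ 1)
    (hlim : ∀ᵐ r : ℝ, r ∈ Ioc s t → Tendsto (fun n => vn n r) atTop (𝓝 (v r))) :
    Tendsto (fun n => ∫ r in s..t, distF (nuN μ s t n) r * zetaFn β r * vn n r) atTop
      (𝓝 (∫ r in s..t, distF μ r * zetaFn β r * v r)) := by
  obtain ⟨L, -, hL⟩ := zeta_bdd hβ
  refine intervalIntegral.tendsto_integral_filter_of_dominated_convergence (fun _ => L) ?_ ?_ ?_ ?_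
  · refine Eventually.of_forall fun n => ?_
    rw [uIoc_of_le hst.le]
    exact ((distF_meas (nuN_memM hst hμ n)).aestronglyMeasurable.mul (zeta_aesm hβ hs ht)).mul
      (hm n).aestronglyMeasurable
  · refine Eventually.of_forall fun n => Eventually.of_forall fun r hr => ?_
    rw [uIoc_of_le hst.le] at hr
    exact weight_le hL (nuN_memM hst hμ n) ⟨hs.trans hr.1.le, hr.2.trans ht⟩ (h1 n r)
  · simp
  · filter_upwards [nuN_tendsto hst hμ, hlim] with r h2 h3 hr
    rw [uIoc_of_le hst.le] at hr
    exact ((h2 ⟨hs.trans hr.1.le, hr.2.trans ht⟩).mul_const _).mul (h3 hr)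

variable {Ω : Type*} [mΩ : MeasurableSpace Ω] {P : Measure Ω} [IsProbabilityMeasure P]
  {Φ : Measure ℝ → ℝ → ℝ → ℝ} {B : ℝ → Ω → ℝ} {x : ℝ}

lemma F_tendsto (hβ : ValidBeta β) (hΦ : IsParisiFamily β Φ) (hB : IsStdBM P B)
    (hμ : MemM μ) (hs : 0 ≤ s) (hst : s < t) (ht : t ≤ 1)
    {un : ℕ → ℝ → Ω → ℝ} {u : ℝ → Ω → ℝ} (hm : ∀ n, Measurable (Function.uncurry (un n)))
    (h1 : ∀ n r ω, |un n r ω| ≤ 1)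
    (hlim : ∀ᵐ ω ∂P, ∀ᵐ r : ℝ, r ∈ Ioc s t → Tendsto (fun n => un n r ω) atTop (𝓝 (u r ω))) :
    Tendsto (fun n => Ffn P β (nuN μ s t n) (Φ (nuN μ s t n)) (fun r => B (xiD β r)) s t (un n) x)
      atTop (𝓝 (Ffn P β μ (Φ μ) (fun r => B (xiD β r)) s t u x)) := by
  obtain ⟨L, hL1, hL⟩ := zeta_bdd hβ
  have ht0 : t ∈ Icc (0 : ℝ) 1 := ⟨hs.trans hst.le, ht⟩
  have hW : Measurable fun ω => B (xiD β t) ω - B (xiD β s) ω := (hB.1 _).sub (hB.1 _)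
  have hWi : Integrable (fun ω => B (xiD β t) ω - B (xiD β s) ω) P :=
    gauss_incr_integrable hW (hB.2.2.2.1 _ _ (xiD_nonneg β hs) (xiD_mono hβ hs hst.le ht))
  obtain ⟨M, hM⟩ : ∃ M, ∀ n, |Φ (nuN μ s t n) t 0| ≤ M := by
    have := (phi_tendsto hst hμ hΦ ht0 0).abs.bddAbove_range
    obtain ⟨M, hM⟩ := this
    exact ⟨M, fun n => hM ⟨n, rfl⟩⟩
  have hsq : ∀ n r ω, |un n r ω ^ 2| ≤ 1 := fun n r ω => by
    rw [abs_pow]; exact pow_le_one₀ (abs_nonneg _) (h1 n r ω)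
  have hsec : ∀ n ω, Measurable fun r => un n r ω := fun n ω =>
    (hm n).comp (measurable_id.prodMk measurable_const)
  unfold Ffn
  refine tendsto_integral_of_dominated_convergence
    (fun ω => M + (|x| + L * (t - s) + |B (xiD β t) ω - B (xiD β s) ω|) + L * (t - s)) ?_ ?_ ?_ ?_
  · intro n
    refine Measurable.aestronglyMeasurable (Measurable.sub ?_ (Measurable.const_mul ?_ _))
    · refine (nuN_nice hst hμ hΦ n t ht0).cont.measurable.comp ?_
      exact (measurable_const.add (wint_meas hβ hs hst ht (nuN_memM hst hμ n) (hm n))).add hW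
    · exact wint_meas (v := fun r ω => un n r ω ^ 2) hβ hs hst ht (nuN_memM hst hμ n)
        ((hm n).pow_const 2)
  · exact (((integrable_const M).add ((integrable_const _).add hWi.abs)).add (integrable_const _))
  · intro n
    refine Eventually.of_forall fun ω => ?_
    have e1 := wint_abs hs hst ht hL (nuN_memM hst hμ n) (v := fun r => un n r ω) (fun r => h1 n r ω)
    have e2 := wint_abs hs hst ht hL (nuN_memM hst hμ n) (v := fun r => un n r ω ^ 2)
      (fun r => hsq n r ω)
    set I := ∫ r in s..t, distF (nuN μ s t n) r * zetaFn β r * un n r ω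
    set J := ∫ r in s..t, distF (nuN μ s t n) r * zetaFn β r * un n r ω ^ 2
    set w := B (xiD β t) ω - B (xiD β s) ω
    have e3 := lip_growth (nuN_nice hst hμ hΦ n t ht0).lip (x + I + w)
    have e4 := abs_add_three x I w
    have e5 := hM n
    rw [Real.norm_eq_abs]
    refine (abs_sub _ _).trans ?_
    rw [abs_mul, abs_of_pos (by norm_num : (0 : ℝ) < 1 / 2)]
    have := abs_nonneg J
    linarith
  · filter_upwards [hlim] with ω hω
    have l1 := wint_tendsto hβ hs hst ht hμ (fun n => hsec n ω) (fun n r => h1 n r ω) hω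
    have l2 := wint_tendsto hβ hs hst ht hμ (fun n => (hsec n ω).pow_const 2)
      (v := fun r => u r ω ^ 2) (fun n r => hsq n r ω)
      (by filter_upwards [hω] with r hr hr1; exact (hr hr1).pow 2)
    refine Tendsto.sub ?_ (l2.const_mul _)
    have l3 := (l1.const_add x).add_const (B (xiD β t) ω - B (xiD β s) ω)
    set w := B (xiD β t) ω - B (xiD β s) ω
    set y := x + (∫ r in s..t, distF μ r * zetaFn β r * u r ω) + w
    have l4 := phi_tendsto hst hμ hΦ ht0 y
    have l5 : Tendsto (fun n => Φ (nuN μ s t n) t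
        (x + (∫ r in s..t, distF (nuN μ s t n) r * zetaFn β r * un n r ω) + w)
        - Φ (nuN μ s t n) t y) atTop (𝓝 0) := by
      have l6 := (tendsto_iff_norm_sub_tendsto_zero.1 l3)
      exact squeeze_zero_norm (fun n => (nuN_nice hst hμ hΦ n t ht0).lip _ _) l6
    have := l5.add l4
    simpa using this
end

end

section
open scoped Topology

section
variable {s t : ℝ} {μ : Measure ℝ} {β : ℕ → ℝ}

def cutU {Ω : Type*} (s b : ℝ) (u : ℝ → Ω → ℝ) (r : ℝ) (ω : Ω) : ℝ :=
  open Classical in if r ∈ Icc s b then u r ω else 0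

lemma cut_meas {Ω : Type*} [MeasurableSpace Ω] {u : ℝ → Ω → ℝ} {i : ℝ}
    (h : Measurable fun p : Iic i × Ω => u p.1 p.2) (s : ℝ) :
    Measurable (Function.uncurry (cutU s i u)) := by
  classical
  set S : Set (ℝ × Ω) := {p | p.1 ∈ Icc s i} with hS
  have hSm : MeasurableSet S := measurable_fst measurableSet_Icc
  have h1 : Measurable fun p : S => u p.1.1 p.1.2 := by
    have : Measurable fun p : S => ((⟨p.1.1, p.2.2⟩, p.1.2) : Iic i × Ω) :=
      ((measurable_fst.comp measurable_subtype_coe).subtype_mk).prodMk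
        (measurable_snd.comp measurable_subtype_coe)
    exact h.comp this
  have h2 := Measurable.dite h1 (show Measurable fun _ : (Sᶜ : Set (ℝ × Ω)) => (0 : ℝ) from measurable_const) hSm
  convert h2 using 1
  funext p
  by_cases hp : p ∈ S
  · rw [dif_pos hp]; exact if_pos hp
  · rw [dif_neg hp]; exact if_neg hp

lemma cut_abs {Ω : Type*} {u : ℝ → Ω → ℝ} (hu : ∀ r ∈ Icc s t, ∀ ω, |u r ω| ≤ 1) (r : ℝ) (ω : Ω) :
    |cutU s t u r ω| ≤ 1 := by
  unfold cutU
  split_ifs with h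
  · exact hu r h ω
  · simp

/-- averages over the previous cell -/
def avU {Ω : Type*} (s t : ℝ) (n : ℕ) (v : ℝ → Ω → ℝ) (k : ℕ) (ω : Ω) : ℝ :=
  if k = 0 then 0 else (stp s t n)⁻¹ * ∫ r in (pt s t n k - stp s t n)..pt s t n k, v r ω

lemma avU_abs {Ω : Type*} (hst : s < t) (n : ℕ) {v : ℝ → Ω → ℝ} (hv : ∀ r ω, |v r ω| ≤ 1)
    (k : ℕ) (ω : Ω) : |avU s t n v k ω| ≤ 1 := by
  unfold avU
  have h := stp_pos hst n
  split_ifs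
  · simp
  · have h1 := intervalIntegral.norm_integral_le_of_norm_le_const (a := pt s t n k - stp s t n)
      (b := pt s t n k) (C := 1) (f := fun r => v r ω) (fun r _ => hv r ω)
    rw [sub_sub_cancel, abs_of_pos h, Real.norm_eq_abs, one_mul] at h1
    rw [abs_mul, abs_of_pos (inv_pos.2 h), inv_mul_le_iff₀ h, mul_one]
    exact h1

lemma avU_meas {Ω : Type*} [MeasurableSpace Ω] (hst : s < t) (n : ℕ) {v : ℝ → Ω → ℝ}
    (hv : Measurable (Function.uncurry v)) (k : ℕ) : Measurable (avU s t n v k) := by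
  unfold avU
  have h := stp_pos hst n
  split_ifs
  · exact measurable_const
  · exact (pint_meas hv (by linarith)).const_mul _

lemma avU_cut {Ω : Type*} (hst : s < t) {n k : ℕ} (hk : k ≤ n) (u : ℝ → Ω → ℝ) :
    avU s t n (cutU s t u) k = avU s t n (cutU s (pt s t n k) u) k := by
  funext ω
  unfold avU
  have h := stp_pos hst n
  split_ifs
  · rfl
  · congr 1
    refine intervalIntegral.integral_congr fun r hr => ?_
    rw [uIcc_of_le (by linarith)] at hr
    have := (pt_mem hst (show k ≤ n + 1 by omega)).2
    unfold cutU
    have e : r ∈ Icc s t ↔ r ∈ Icc s (pt s t n k) :=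
      ⟨fun h => ⟨h.1, hr.2⟩, fun h => ⟨h.1, h.2.trans this⟩⟩
    simp only [e]

lemma pcu_meas {Ω : Type*} [MeasurableSpace Ω] {n : ℕ} {U : ℕ → Ω → ℝ}
    (hU : ∀ k, Measurable (U k)) : Measurable (Function.uncurry (pcu s t n U)) := by
  classical
  have h1 : Measurable (Function.uncurry U) := measurable_from_prod_countable_right hU
  have h2 : Measurable fun p : ℝ × Ω => U ⌊(p.1 - s) / stp s t n⌋₊ p.2 :=
    h1.comp ((((measurable_fst.sub_const s).div_const _).nat_floor).prodMk measurable_snd)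
  exact Measurable.ite (measurable_fst measurableSet_Ico) h2 measurable_const

lemma av_tendsto (hst : s < t) {v : ℝ → ℝ} (hv : Measurable v) (hv1 : ∀ r, |v r| ≤ 1) :
    ∀ᵐ r : ℝ, r ∈ Ioc s t → Tendsto (fun n => pcu s t n (avU s t n (fun r (_ : Unit) => v r)) r ())
      atTop (𝓝 (v r)) := by
  have hloc : LocallyIntegrable v volume := by
    refine MeasureTheory.LocallyIntegrable.mono (f := fun _ => (1 : ℝ))
      (locallyIntegrable_const 1) hv.aestronglyMeasurable (Eventually.of_forall fun r => ?_)
    simpa using hv1 r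
  have hne : ∀ᵐ r : ℝ, r ≠ t := by
    have := (countable_singleton t).ae_notMem volume
    filter_upwards [this] with r hr; exact hr
  filter_upwards [IsUnifLocDoublingMeasure.ae_tendsto_average volume hloc 3, hne] with r hr hrt hrst
  have hr' : r ∈ Ico s t := ⟨hrst.1.le, lt_of_le_of_ne hrst.2 hrt⟩
  have hδ : Tendsto (fun n => stp s t n / 2) atTop (𝓝[>] 0) := by
    rw [tendsto_nhdsWithin_iff]
    refine ⟨?_, Eventually.of_forall fun n => half_pos (stp_pos hst n)⟩
    have := (stp_tendsto s t).div_const 2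
    simpa using this
  have key := hr (fun n => pt s t n ⌊(r - s) / stp s t n⌋₊ - stp s t n / 2) _ hδ ?_
  · refine key.congr' ?_
    filter_upwards [(stp_tendsto s t).eventually (gt_mem_nhds (sub_pos.2 hrst.1))] with n hn
    obtain ⟨k, hk, hrk⟩ := exists_cell hst n hr'
    have h := stp_pos hst n
    rw [pcu_cell hst hk _ hrk, cell_floor hst hrk]
    have hk0 : k ≠ 0 := by
      rintro rfl
      have := hrk.2
      rw [pt_succ, pt_zero] at this
      linarith
    unfold avU
    rw [if_neg hk0, setAverage_eq, Real.closedBall_eq_Icc, smul_eq_mul]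
    congr 1
    · rw [Measure.real, Real.volume_Icc]
      rw [ENNReal.toReal_ofReal (by linarith)]
      congr 1; ring
    · rw [intervalIntegral.integral_of_le (by linarith), integral_Icc_eq_integral_Ioc]
      congr 3 <;> ring
  · refine Eventually.of_forall fun n => ?_
    obtain ⟨k, hk, hrk⟩ := exists_cell hst n hr'
    rw [cell_floor hst hrk, Real.closedBall_eq_Icc]
    obtain ⟨h1, h2⟩ := hrk
    rw [pt_succ] at h2
    have h := stp_pos hst n
    constructor <;> linarith

variable {Ω : Type*} [mΩ : MeasurableSpace Ω] {P : Measure Ω} [IsProbabilityMeasure P]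
  {Φ : Measure ℝ → ℝ → ℝ → ℝ} {B : ℝ → Ω → ℝ} {𝓕 : Filtration ℝ mΩ} {x : ℝ}

/-- the chain driven by an open-loop control -/
def olX (β : ℕ → ℝ) (B : ℝ → Ω → ℝ) (ν : Measure ℝ) (s t : ℝ) (n : ℕ) (x : ℝ) (U : ℕ → Ω → ℝ) :
    ℕ → Ω → ℝ
  | 0, _ => x
  | k + 1, ω => olX β B ν s t n x U k ω + distF ν (pt s t n k)
      * (xiD β (pt s t n (k + 1)) - xiD β (pt s t n k)) * U k ω
      + (B (xiD β (pt s t n (k + 1))) ω - B (xiD β (pt s t n k)) ω)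

lemma prog_cut {u : ℝ → Ω → ℝ} (hu : ProgMeasurable 𝓕 u) (s i : ℝ) :
    @Measurable _ _ (@Prod.instMeasurableSpace ℝ Ω _ (𝓕 i)) _ (Function.uncurry (cutU s i u)) := by
  have h1 := hu i
  have h2 := h1.measurable
  exact @cut_meas Ω (𝓕 i) u i h2 s

lemma upper_bound (hβ : ValidBeta β) (hΦ : IsParisiFamily β Φ) (hB : IsStdBM P B)
    (h𝓕 : ∀ r : ℝ, (𝓕 r : MeasurableSpace Ω)
      = ⨆ v ∈ Icc (0 : ℝ) r, MeasurableSpace.comap (fun ω => B (xiD β v) ω) inferInstance)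
    (hμ : MemM μ) (hs : 0 ≤ s) (hst : s < t) (ht : t ≤ 1) {u : ℝ → Ω → ℝ} (hu : InD 𝓕 s t u) :
    Ffn P β μ (Φ μ) (fun r => B (xiD β r)) s t u x ≤ Φ μ s x := by
  set v := cutU s t u with hv
  have hvm : Measurable (Function.uncurry v) := by
    refine (prog_cut hu.1 s t).mono ?_ le_rfl
    exact sup_le_sup_left (MeasurableSpace.comap_mono (𝓕.le t)) _
  have hv1 : ∀ r ω, |v r ω| ≤ 1 := cut_abs hu.2
  have hF : Ffn P β μ (Φ μ) (fun r => B (xiD β r)) s t u x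
      = Ffn P β μ (Φ μ) (fun r => B (xiD β r)) s t v x := by
    unfold Ffn
    have e : ∀ ω, ∀ r ∈ uIcc s t, v r ω = u r ω := by
      intro ω r hr
      rw [uIcc_of_le hst.le] at hr
      rw [hv]; unfold cutU; rw [if_pos hr]
    congr 1
    funext ω
    congr 2
    · congr 2
      exact intervalIntegral.integral_congr fun r hr => by simp only [e ω r hr]
    · exact intervalIntegral.integral_congr fun r hr => by simp only [e ω r hr]
  rw [hF]
  have hch : ∀ n, gChain P β Φ B 𝓕 μ s t n (avU s t n v)
      (olX β B (nuN μ s t n) s t n x (avU s t n v)) x := by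
    intro n
    refine mkChain hβ hΦ hB h𝓕 hμ hs hst ht n (fun ω => rfl) (fun k _ ω => rfl) ?_
      (fun k _ ω => avU_abs hst n hv1 k ω)
    intro k hk _
    rw [hv, avU_cut hst (by omega) u]
    exact @avU_meas s t Ω (𝓕 (pt s t n k)) hst n _ (prog_cut hu.1 s (pt s t n k)) k
  refine le_of_tendsto_of_tendsto' (F_tendsto hβ hΦ hB hμ hs hst ht
    (un := fun n => pcu s t n (avU s t n v)) (u := v) ?_ ?_ ?_)
    (phi_tendsto hst hμ hΦ ⟨hs, hst.le.trans ht⟩ x) fun n => chain_upper hβ hμ hs hst ht (hch n)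
  · intro n
    exact pcu_meas fun k => avU_meas hst n hvm k
  · intro n r ω
    exact pcu_abs hst (fun k _ ω => avU_abs hst n hv1 k ω) r ω
  · refine Eventually.of_forall fun ω => ?_
    exact av_tendsto hst (v := fun r => v r ω)
      (hvm.comp (measurable_id.prodMk measurable_const)) (fun r => hv1 r ω)
end

end

section
open scoped Topology

section
variable {s t : ℝ} {μ : Measure ℝ} {β : ℕ → ℝ} {L : ℝ}

lemma gron {g : ℝ → ℝ} {a K : ℝ} (hK : 0 < K) (hg : Measurable g) (hg2 : ∀ r, |g r| ≤ 2)
    (h : ∀ r ∈ Ico s t, g r ≤ a + K * ∫ q in s..r, g q) (h0 : ∀ r, 0 ≤ g r) :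
    ∀ r ∈ Ico s t, g r ≤ 2 * a * exp (2 * K * (r - s)) := by
  intro r₀ hr₀
  set G : Ico s t → ℝ := fun r => g r * exp (-(2 * K * (r.1 - s))) with hG
  haveI : Nonempty (Ico s t) := ⟨⟨r₀, hr₀⟩⟩
  have hbdd : BddAbove (range G) := by
    refine ⟨2, ?_⟩
    rintro _ ⟨r, rfl⟩
    have h1 : exp (-(2 * K * (r.1 - s))) ≤ 1 := by
      rw [exp_le_one_iff]
      have := mul_nonneg hK.le (sub_nonneg.2 r.2.1)
      linarith
    have h2 := (abs_le.1 (hg2 r)).2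
    have h3 := h0 r
    have h4 := exp_pos (-(2 * K * (r.1 - s)))
    simp only [hG]
    nlinarith
  set M := ⨆ r, G r with hM
  have hle : ∀ r ∈ Ico s t, g r ≤ M * exp (2 * K * (r - s)) := by
    intro r hr
    have h1 := le_ciSup hbdd ⟨r, hr⟩
    simp only [hG] at h1
    rw [exp_neg, ← div_eq_mul_inv, div_le_iff₀ (exp_pos _)] at h1
    exact h1
  have hM0 : 0 ≤ M := by
    have h1 := hle r₀ hr₀
    have h2 := h0 r₀
    by_contra hc
    have := mul_neg_of_neg_of_pos (not_le.1 hc) (exp_pos (2 * K * (r₀ - s)))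
    linarith
  have hIntg : ∀ a b, IntervalIntegrable g volume a b := by
    intro a b
    refine (intervalIntegrable_const (c := (2 : ℝ))).mono_fun hg.aestronglyMeasurable ?_
    refine Eventually.of_forall fun r => ?_
    exact (hg2 r).trans (le_abs_self 2)
  have hexp : ∀ r, ∫ q in s..r, M * exp (2 * K * (q - s)) = M * ((exp (2 * K * (r - s)) - 1) / (2 * K)) := by
    intro r
    rw [intervalIntegral.integral_const_mul]
    congr 1
    have hd : ∀ q ∈ uIcc s r, HasDerivAt (fun q => exp (2 * K * (q - s)) / (2 * K))
        (exp (2 * K * (q - s))) q := by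
      intro q _
      have h1 : HasDerivAt (fun q => 2 * K * (q - s)) (2 * K) q := by
        simpa using ((hasDerivAt_id q).sub_const s).const_mul (2 * K)
      have h2 := h1.exp.div_const (2 * K)
      exact h2.congr_deriv (mul_div_cancel_right₀ _ (show (2 * K : ℝ) ≠ 0 by positivity))
    rw [intervalIntegral.integral_eq_sub_of_hasDerivAt hd
      (Continuous.intervalIntegrable (by fun_prop) _ _)]
    simp; ring
  have hMle : M ≤ a + M / 2 := by
    have ha : ∀ r ∈ Ico s t, g r ≤ a + M / 2 * (exp (2 * K * (r - s)) - 1) := by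
      intro r hr
      have h1 : ∫ q in s..r, g q ≤ ∫ q in s..r, M * exp (2 * K * (q - s)) := by
        refine intervalIntegral.integral_mono_on hr.1 (hIntg _ _)
          (Continuous.intervalIntegrable (by fun_prop) _ _) fun q hq => ?_
        exact hle q ⟨hq.1, hq.2.trans_lt hr.2⟩
      rw [hexp] at h1
      have h2 := mul_le_mul_of_nonneg_left h1 hK.le
      have h3 : K * (M * ((exp (2 * K * (r - s)) - 1) / (2 * K)))
          = M / 2 * (exp (2 * K * (r - s)) - 1) := by field_simp
      have := h r hr
      linarith
    have ha0 : 0 ≤ a := by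
      have hs : s ∈ Ico s t := ⟨le_rfl, hr₀.1.trans_lt hr₀.2⟩
      have := h s hs
      rw [intervalIntegral.integral_same] at this
      linarith [h0 s]
    refine ciSup_le fun r => ?_
    simp only [hG]
    rw [exp_neg, ← div_eq_mul_inv, div_le_iff₀ (exp_pos _)]
    have h1 := ha r r.2
    have h2 : 1 ≤ exp (2 * K * (r.1 - s)) := by
      rw [one_le_exp_iff]
      have := mul_nonneg hK.le (sub_nonneg.2 r.2.1)
      linarith
    nlinarith
  have := mul_le_mul_of_nonneg_right (show M ≤ 2 * a by linarith) (exp_pos (2 * K * (r₀ - s))).le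
  exact (hle r₀ hr₀).trans this

lemma Ydiff (hβ : ValidBeta β) (hs : 0 ≤ s) (hst : s < t) (ht : t ≤ 1) (hμ : MemM μ)
    (hL : ∀ r ∈ Icc (0 : ℝ) 1, zetaFn β r ≤ L) {ν ν' : Measure ℝ} (hν : MemM ν) (hν' : MemM ν')
    {v v' : ℝ → ℝ} (hv : Measurable v) (hv' : Measurable v') (h1 : ∀ r, |v r| ≤ 1)
    (h1' : ∀ r, |v' r| ≤ 1) {r : ℝ} (hr : r ∈ Ico s t) :
    |(∫ q in s..r, distF ν q * zetaFn β q * v q) - ∫ q in s..r, distF ν' q * zetaFn β q * v' q|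
      ≤ L * (dM μ ν + dM μ ν') + L * ∫ q in s..r, |v q - v' q| := by
  have hr1 : r ≤ 1 := hr.2.le.trans ht
  have hbi : ∀ (f : ℝ → ℝ) (M a b : ℝ), AEStronglyMeasurable f (volume.restrict (uIoc a b)) →
      (∀ q ∈ uIoc a b, |f q| ≤ M) → IntervalIntegrable f volume a b := by
    intro f M a b hf hM
    refine (intervalIntegrable_const (c := M)).mono_fun hf ?_
    refine (ae_restrict_mem measurableSet_uIoc).mono fun q hq => ?_
    exact (hM q hq).trans (le_abs_self M)
  have hmem : ∀ q ∈ uIoc s r, q ∈ Icc (0 : ℝ) 1 := by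
    intro q hq
    rw [uIoc_of_le hr.1] at hq
    exact ⟨hs.trans hq.1.le, hq.2.trans hr1⟩
  have hwi : ∀ {ν : Measure ℝ} {v : ℝ → ℝ}, MemM ν → Measurable v → (∀ r, |v r| ≤ 1) →
      IntervalIntegrable (fun q => distF ν q * zetaFn β q * v q) volume s r := by
    intro ν v hν hv h1
    refine hbi _ L s r ?_ fun q hq => weight_le hL hν (hmem q hq) (h1 q)
    rw [uIoc_of_le hr.1]
    exact ((distF_meas hν).aestronglyMeasurable.mul (zeta_aesm hβ hs hr1)).mul
      hv.aestronglyMeasurable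
  have hdi : ∀ {ν : Measure ℝ}, MemM ν → ∀ a b,
      IntervalIntegrable (fun q => |distF μ q - distF ν q|) volume a b := by
    intro ν hν a b
    refine hbi _ 1 a b ((distF_meas hμ).sub (distF_meas hν)).abs.aestronglyMeasurable fun q _ => ?_
    rw [abs_abs, abs_le]
    have := distF_nonneg μ q
    have := distF_nonneg ν q
    have := distF_le_one hμ q
    have := distF_le_one hν q
    constructor <;> linarith
  have hdm : ∀ {ν : Measure ℝ}, MemM ν →
      ∫ q in s..r, |distF μ q - distF ν q| ≤ dM μ ν := by
    intro ν hν
    unfold dM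
    exact intervalIntegral.integral_mono_interval hs hr.1 hr1
      (Eventually.of_forall fun q => abs_nonneg _) (hdi hν _ _)
  have hvi : IntervalIntegrable (fun q => |v q - v' q|) volume s r := by
    refine hbi _ 2 s r (hv.sub hv').abs.aestronglyMeasurable fun q _ => ?_
    rw [abs_abs]
    have := abs_sub (v q) (v' q)
    linarith [h1 q, h1' q]
  have hL0 : 0 ≤ L := (zeta_nonneg β le_rfl).trans (hL 0 ⟨le_rfl, zero_le_one⟩)
  rw [← intervalIntegral.integral_sub (hwi hν hv h1) (hwi hν' hv' h1')]
  refine (intervalIntegral.abs_integral_le_integral_abs hr.1).trans ?_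
  have hbd : ∫ q in s..r, |distF ν q * zetaFn β q * v q - distF ν' q * zetaFn β q * v' q|
      ≤ ∫ q in s..r, (L * (|distF μ q - distF ν q| + |distF μ q - distF ν' q|)
        + L * |v q - v' q|) := by
    refine intervalIntegral.integral_mono_on hr.1 ((hwi hν hv h1).sub (hwi hν' hv' h1')).abs
      ((((hdi hν _ _).add (hdi hν' _ _)).const_mul L).add (hvi.const_mul L)) fun q hq => ?_
    have hq1 : q ∈ Icc (0 : ℝ) 1 := ⟨hs.trans hq.1, hq.2.trans hr1⟩
    have hz := zeta_nonneg β hq1.1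
    have e : distF ν q * zetaFn β q * v q - distF ν' q * zetaFn β q * v' q
        = zetaFn β q * ((distF ν q - distF ν' q) * v q + distF ν' q * (v q - v' q)) := by ring
    rw [e, abs_mul, abs_of_nonneg hz, ← mul_add]
    have e1 : |(distF ν q - distF ν' q) * v q + distF ν' q * (v q - v' q)|
        ≤ |distF μ q - distF ν q| + |distF μ q - distF ν' q| + |v q - v' q| := by
      refine (abs_add_le _ _).trans ?_
      rw [abs_mul, abs_mul, abs_of_nonneg (distF_nonneg ν' q)]
      have a1 : |distF ν q - distF ν' q| ≤ |distF μ q - distF ν q| + |distF μ q - distF ν' q| := by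
        have := abs_sub_le (distF ν q) (distF μ q) (distF ν' q)
        rwa [abs_sub_comm (distF ν q) (distF μ q)] at this
      have a2 := mul_le_of_le_one_right (abs_nonneg (distF ν q - distF ν' q)) (h1 q)
      have a3 := mul_le_of_le_one_left (abs_nonneg (v q - v' q)) (distF_le_one hν' q)
      linarith
    exact mul_le_mul (hL q hq1) e1 (abs_nonneg _) hL0
  refine hbd.trans ?_
  rw [intervalIntegral.integral_add (((hdi hν _ _).add (hdi hν' _ _)).const_mul L) (hvi.const_mul L),
    intervalIntegral.integral_const_mul, intervalIntegral.integral_const_mul,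
    intervalIntegral.integral_add (hdi hν _ _) (hdi hν' _ _)]
  have := mul_le_mul_of_nonneg_left (add_le_add (hdm hν) (hdm hν')) hL0
  linarith

lemma path_cauchy (hβ : ValidBeta β) (hs : 0 ≤ s) (hst : s < t) (ht : t ≤ 1) (hμ : MemM μ)
    {un : ℕ → ℝ → ℝ} (hm : ∀ n, Measurable (un n)) (h1 : ∀ n r, |un n r| ≤ 1)
    {f : ℝ → ℝ → ℝ} (hf : ∀ r ∈ Ico s t, ∀ x y, |f r x - f r y| ≤ 4 * |x - y|) {w : ℝ → ℝ}
    (h : ∀ ε : ℝ, 0 < ε → ∀ᶠ n in atTop, ∀ r ∈ Ico s t,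
      |un n r - f r ((∫ q in s..r, distF (nuN μ s t n) q * zetaFn β q * un n q) + w r)| ≤ ε)
    {r : ℝ} (hr : r ∈ Ico s t) : CauchySeq fun n => un n r := by
  obtain ⟨L, hL1, hL⟩ := zeta_bdd hβ
  rw [Metric.cauchySeq_iff]
  intro ε hε
  set E := exp (2 * (4 * L) * (r - s)) with hE
  have hE0 : 0 < E := exp_pos _
  set η := ε / (E * (8 + 16 * L)) with hη
  have hη0 : 0 < η := by positivity
  have ev := (h η hη0).and ((dM_tendsto hst hμ).eventually (gt_mem_nhds hη0))
  obtain ⟨N, hN⟩ := eventually_atTop.1 ev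
  refine ⟨N, fun n hn m hm' => ?_⟩
  obtain ⟨n1, n2⟩ := hN n hn
  obtain ⟨m1, m2⟩ := hN m hm'
  have key := gron (s := s) (t := t) (g := fun r => |un n r - un m r|) (a := 2 * η + 4 * L * (2 * η))
    (K := 4 * L) (by linarith) ((hm n).sub (hm m)).abs (fun r => by
      rw [abs_abs]; have := abs_sub (un n r) (un m r); linarith [h1 n r, h1 m r]) (fun r hr => by
      have b1 := n1 r hr
      have b2 := m1 r hr
      have b3 := Ydiff hβ hs hst ht hμ hL (nuN_memM hst hμ n) (nuN_memM hst hμ m) (hm n) (hm m)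
        (h1 n) (h1 m) hr
      set Y := ∫ q in s..r, distF (nuN μ s t n) q * zetaFn β q * un n q
      set Z := ∫ q in s..r, distF (nuN μ s t m) q * zetaFn β q * un m q
      have b4 := hf r hr (Y + w r) (Z + w r)
      rw [add_sub_add_right_eq_sub] at b4
      have b5 : L * (dM μ (nuN μ s t n) + dM μ (nuN μ s t m)) ≤ L * (2 * η) :=
        mul_le_mul_of_nonneg_left (by linarith) (by linarith)
      rw [abs_le] at b1 b2 b4 ⊢
      constructor <;> linarith) (fun r => abs_nonneg _) r hr
  rw [Real.dist_eq]
  refine key.trans_lt ?_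
  have e : η * (E * (8 + 16 * L)) = ε := by
    rw [hη]; field_simp
  nlinarith [mul_pos hη0 hE0]
end

end

section
open scoped Topology

section
variable {s t : ℝ} {n : ℕ} {μ : Measure ℝ} {β : ℕ → ℝ} {L : ℝ}
  {Ω : Type*} [mΩ : MeasurableSpace Ω] {P : Measure Ω} [IsProbabilityMeasure P]
  {Φ : Measure ℝ → ℝ → ℝ → ℝ} {B : ℝ → Ω → ℝ} {𝓕 : Filtration ℝ mΩ} {x : ℝ}

/-- the feedback chain -/
def fbX (β : ℕ → ℝ) (B : ℝ → Ω → ℝ) (ν : Measure ℝ) (f : ℕ → ℝ → ℝ) (s t : ℝ) (n : ℕ) (x : ℝ) :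
    ℕ → Ω → ℝ
  | 0, _ => x
  | k + 1, ω => fbX β B ν f s t n x k ω + distF ν (pt s t n k)
      * (xiD β (pt s t n (k + 1)) - xiD β (pt s t n k)) * f k (fbX β B ν f s t n x k ω)
      + (B (xiD β (pt s t n (k + 1))) ω - B (xiD β (pt s t n k)) ω)

lemma fbX_meas (hB : ∀ r, Measurable (B r)) {ν : Measure ℝ} {f : ℕ → ℝ → ℝ}
    (hf : ∀ k, Measurable (f k)) (k : ℕ) : Measurable (fbX β B ν f s t n x k) := by
  induction k with
  | zero => exact measurable_const
  | succ k ih =>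
    exact (ih.add (((hf k).comp ih).const_mul _)).add ((hB _).sub (hB _))

/-- the feedback coefficients -/
def fbf (Φ : Measure ℝ → ℝ → ℝ → ℝ) (μ : Measure ℝ) (s t : ℝ) (n : ℕ) (k : ℕ) : ℝ → ℝ :=
  deriv (Φ (nuN μ s t n) (pt s t n (k + 1)))

/-- the feedback state -/
def fbS (β : ℕ → ℝ) (B : ℝ → Ω → ℝ) (Φ : Measure ℝ → ℝ → ℝ → ℝ) (μ : Measure ℝ) (s t x : ℝ) (n : ℕ)
    (k : ℕ) (ω : Ω) : ℝ :=
  fbX β B (nuN μ s t n) (fbf Φ μ s t n) s t n x k ω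

/-- the feedback control -/
def fbU (β : ℕ → ℝ) (B : ℝ → Ω → ℝ) (Φ : Measure ℝ → ℝ → ℝ → ℝ) (μ : Measure ℝ) (s t x : ℝ) (n : ℕ)
    (k : ℕ) (ω : Ω) : ℝ :=
  fbf Φ μ s t n k (fbS β B Φ μ s t x n k ω)

lemma fbU_meas (hB : ∀ r, Measurable (B r)) (k : ℕ) : Measurable (fbU β B Φ μ s t x n k) :=
  (measurable_deriv _).comp (fbX_meas hB (fun _ => measurable_deriv _) k)

lemma fbU_abs (hΦ : IsParisiFamily β Φ) (hμ : MemM μ) (hs : 0 ≤ s) (hst : s < t) (ht : t ≤ 1) :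
    ∀ k < n + 1, ∀ ω, |fbU β B Φ μ s t x n k ω| ≤ 1 := by
  intro k hk ω
  have hm := pt_mem hst (show k + 1 ≤ n + 1 by omega)
  exact (nuN_nice hst hμ hΦ n _ ⟨hs.trans hm.1, hm.2.trans ht⟩).deriv_abs_le _

lemma fb_chain (hβ : ValidBeta β) (hΦ : IsParisiFamily β Φ) (hB : IsStdBM P B)
    (h𝓕 : ∀ r : ℝ, (𝓕 r : MeasurableSpace Ω)
      = ⨆ v ∈ Icc (0 : ℝ) r, MeasurableSpace.comap (fun ω => B (xiD β v) ω) inferInstance)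
    (hμ : MemM μ) (hs : 0 ≤ s) (hst : s < t) (ht : t ≤ 1) (n : ℕ) :
    gChain P β Φ B 𝓕 μ s t n (fbU β B Φ μ s t x n) (fbS β B Φ μ s t x n) x := by
  refine mkChain hβ hΦ hB h𝓕 hμ hs hst ht n (fun ω => rfl) (fun k _ ω => rfl) ?_
    (fbU_abs hΦ hμ hs hst ht)
  intro k hk hX
  exact (measurable_deriv _).comp hX

lemma pcu_prog (hst : s < t) {U : ℕ → Ω → ℝ} (hU : ∀ k ≤ n, Measurable[𝓕 (pt s t n k)] (U k)) (i : ℝ) :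
    @Measurable _ _ (@Prod.instMeasurableSpace (Iic i) Ω _ (𝓕 i)) _
      (fun p : Iic i × Ω => pcu s t n U p.1 p.2) := by
  classical
  set V : ℕ → Ω → ℝ := fun k ω => if k ≤ n ∧ pt s t n k ≤ i then U k ω else 0 with hV
  have hVm : ∀ k, Measurable[𝓕 i] (V k) := by
    intro k
    by_cases h : k ≤ n ∧ pt s t n k ≤ i
    · have : V k = U k := by funext ω; simp only [hV]; rw [if_pos h]
      rw [this]
      exact (hU k h.1).mono (𝓕.mono h.2) le_rfl
    · have : V k = fun _ => 0 := by funext ω; simp only [hV]; rw [if_neg h]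
      rw [this]
      exact measurable_const
  have h1 := @pcu_meas s t Ω (𝓕 i) n V hVm
  have h2 : (fun p : Iic i × Ω => pcu s t n U p.1 p.2)
      = Function.uncurry (pcu s t n V) ∘ fun p : Iic i × Ω => ((p.1 : ℝ), p.2) := by
    funext p
    simp only [Function.comp, Function.uncurry]
    by_cases hr : (p.1 : ℝ) ∈ Ico s t
    · obtain ⟨k, hk, hrk⟩ := exists_cell hst n hr
      rw [pcu_cell hst hk U hrk, pcu_cell hst hk V hrk]
      simp only [hV]
      rw [if_pos ⟨hk, hrk.1.trans p.1.2⟩]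
    · rw [pcu_out U hr, pcu_out V hr]
  rw [h2]
  letI : MeasurableSpace Ω := 𝓕 i
  exact h1.comp ((measurable_subtype_coe.comp measurable_fst).prodMk measurable_snd)

lemma wii (hβ : ValidBeta β) (hs : 0 ≤ s) (ht : t ≤ 1)
    (hL : ∀ r ∈ Icc (0 : ℝ) 1, zetaFn β r ≤ L) {ν : Measure ℝ} (hν : MemM ν)
    {v : ℝ → ℝ} (hv : Measurable v) (h1 : ∀ r, |v r| ≤ 1) {a b : ℝ} (ha : s ≤ a) (hab : a ≤ b)
    (hb : b ≤ t) : IntervalIntegrable (fun q => distF ν q * zetaFn β q * v q) volume a b := by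
  refine (intervalIntegrable_const (c := L)).mono_fun ?_ ?_
  · rw [uIoc_of_le hab]
    exact ((distF_meas hν).aestronglyMeasurable.mul (zeta_aesm hβ (hs.trans ha) (hb.trans ht))).mul
      hv.aestronglyMeasurable
  · refine (ae_restrict_mem measurableSet_uIoc).mono fun q hq => ?_
    rw [uIoc_of_le hab] at hq
    exact (weight_le hL hν ⟨hs.trans (ha.trans hq.1.le), hq.2.trans (hb.trans ht)⟩ (h1 q)).trans
      (le_abs_self L)

lemma fb_close (hβ : ValidBeta β) (hΦ : IsParisiFamily β Φ) (hB : IsStdBM P B)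
    (h𝓕 : ∀ r : ℝ, (𝓕 r : MeasurableSpace Ω)
      = ⨆ v ∈ Icc (0 : ℝ) r, MeasurableSpace.comap (fun ω => B (xiD β v) ω) inferInstance)
    (hμ : MemM μ) (hs : 0 ≤ s) (hst : s < t) (ht : t ≤ 1) {ω : Ω}
    (hω : Continuous fun r => B r ω) {ε : ℝ} (hε : 0 < ε) : ∀ᶠ n in atTop, ∀ r ∈ Ico s t,
    |pcu s t n (fbU β B Φ μ s t x n) r ω - deriv (Φ μ r)
      ((∫ q in s..r, distF (nuN μ s t n) q * zetaFn β q * pcu s t n (fbU β B Φ μ s t x n) q ω)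
        + (x + (B (xiD β r) ω - B (xiD β s) ω)))| ≤ ε := by
  obtain ⟨L, hL1, hL⟩ := zeta_bdd hβ
  obtain ⟨C, hC0, hC⟩ := Nice.time_reg
  have hwc : ContinuousOn (fun r => B (xiD β r) ω) (Icc 0 1) :=
    hω.comp_continuousOn (xiD_continuousOn hβ)
  have huc := isCompact_Icc.uniformContinuousOn_of_continuous hwc
  rw [Metric.uniformContinuousOn_iff] at huc
  obtain ⟨δ, hδ, huc⟩ := huc (ε / 16) (by positivity)
  set η := (ε / 6) ^ 2 with hη
  have hη0 : 0 < η := by positivity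
  have hsη : √η = ε / 6 := Real.sqrt_sq (by positivity)
  have hst0 := stp_tendsto s t
  have hl1 : Tendsto (fun n => L * stp s t n) atTop (𝓝 0) := by simpa using hst0.const_mul L
  have hl2 : Tendsto (fun n => C * (L * stp s t n)) atTop (𝓝 0) := by simpa using hl1.const_mul C
  filter_upwards [phi_unif hst hμ hΦ (half_pos hη0), hst0.eventually (gt_mem_nhds hδ),
    hl1.eventually (gt_mem_nhds (show (0 : ℝ) < ε / 16 by positivity)),
    hl1.eventually (gt_mem_nhds (show (0 : ℝ) < 1 by positivity)),
    hl2.eventually (gt_mem_nhds (half_pos hη0))] with n e1 e2 e3 e4 e5 r hr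
  obtain ⟨k, hk, hrk⟩ := exists_cell hst n hr
  have hr01 : r ∈ Icc (0 : ℝ) 1 := ⟨hs.trans hr.1, hr.2.le.trans ht⟩
  have hpk := pt_mem hst (show k ≤ n + 1 by omega)
  have hpk1 := pt_mem hst (show k + 1 ≤ n + 1 by omega)
  have hpk01 : pt s t n k ∈ Icc (0 : ℝ) 1 := ⟨hs.trans hpk.1, hpk.2.trans ht⟩
  have hpk101 : pt s t n (k + 1) ∈ Icc (0 : ℝ) 1 := ⟨hs.trans hpk1.1, hpk1.2.trans ht⟩
  have hps := pt_succ s t n k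
  set U := fbU β B Φ μ s t x n with hU
  have hUa : ∀ q, |pcu s t n U q ω| ≤ 1 := fun q => pcu_abs hst (fbU_abs hΦ hμ hs hst ht) q ω
  have hUm : Measurable fun q => pcu s t n U q ω :=
    (pcu_meas (fun k => fbU_meas hB.1 k)).comp (measurable_id.prodMk measurable_const)
  have hν := nuN_memM hst hμ n
  -- state
  have hX := chain_X (fb_chain hβ hΦ hB h𝓕 hμ hs hst ht n (x := x)) ω k (by omega)
  rw [← cell_integral (v := fun q => pcu s t n U q ω) (w := fun k => U k ω) hβ hs hst ht hμ
    (fun k hk r hr => pcu_cell hst hk U hr ω) (show k ≤ n + 1 by omega)] at hX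
  have hsplit := intervalIntegral.integral_add_adjacent_intervals
    (wii hβ hs ht hL hν hUm hUa le_rfl hpk.1 hpk.2) (wii hβ hs ht hL hν hUm hUa hpk.1 hrk.1 hr.2.le)
  have hsmall : |∫ q in pt s t n k..r, distF (nuN μ s t n) q * zetaFn β q * pcu s t n U q ω|
      ≤ L * stp s t n := by
    have := intervalIntegral.norm_integral_le_of_norm_le_const (a := pt s t n k) (b := r) (C := L)
      (f := fun q => distF (nuN μ s t n) q * zetaFn β q * pcu s t n U q ω) (fun q hq => by
        rw [uIoc_of_le hrk.1] at hq
        exact weight_le hL hν ⟨hpk01.1.trans hq.1.le, hq.2.trans hr01.2⟩ (hUa q))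
    refine this.trans (mul_le_mul_of_nonneg_left ?_ (by linarith))
    rw [abs_of_nonneg (sub_nonneg.2 hrk.1)]
    linarith [hrk.2]
  have hosc := huc _ hpk01 r hr01 (by
    rw [Real.dist_eq, abs_sub_comm, abs_of_nonneg (sub_nonneg.2 hrk.1)]
    linarith [hrk.2])
  rw [Real.dist_eq] at hosc
  rw [pcu_cell hst hk U hrk]
  have hUk : U k ω = deriv (Φ (nuN μ s t n) (pt s t n (k + 1))) (fbS β B Φ μ s t x n k ω) := rfl
  rw [hUk]
  set X := fbS β B Φ μ s t x n k ω with hXd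
  -- coefficients
  have hcl : ∀ z, |Φ (nuN μ s t n) (pt s t n (k + 1)) z - Φ μ r z| ≤ η := by
    intro z
    have c1 := (e1 r hr01 z).le
    have c2 : |Φ (nuN μ s t n) r z - Φ (nuN μ s t n) (pt s t n (k + 1)) z| ≤ η / 2 := by
      rw [phi_cell hβ hs hst ht hμ hΦ hk hrk z]
      have hv0 := xiD_mono hβ hr01.1 hrk.2.le hpk101.2
      have hv1 := xiD_lip hβ hL hr01.1 hrk.2.le hpk101.2
      have hv2 : L * (pt s t n (k + 1) - r) ≤ L * stp s t n :=
        mul_le_mul_of_nonneg_left (by linarith [hrk.1]) (by linarith)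
      have c3 := hC _ (nuN_nice hst hμ hΦ n _ hpk101) (distF (nuN μ s t n) (pt s t n k))
        (distF_pos hν (nuN_zero μ s t n) hpk01.1) (distF_le_one hν _)
        (xiD β (pt s t n (k + 1)) - xiD β r) (by linarith) (by linarith) z
      refine c3.trans ?_
      have := mul_le_mul_of_nonneg_left (hv1.trans hv2) hC0
      linarith
    rw [abs_le] at c1 c2 ⊢
    constructor <;> linarith
  have d1 := (nuN_nice hst hμ hΦ n _ hpk101).deriv_close (phi_nice hμ hΦ hr01) hη0 hcl X
  rw [hsη] at d1
  have d2 := (phi_nice hμ hΦ hr01).deriv_lip X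
    ((∫ q in s..r, distF (nuN μ s t n) q * zetaFn β q * pcu s t n U q ω)
        + (x + (B (xiD β r) ω - B (xiD β s) ω)))
  have d3 : |X - ((∫ q in s..r, distF (nuN μ s t n) q * zetaFn β q * pcu s t n U q ω)
        + (x + (B (xiD β r) ω - B (xiD β s) ω)))| ≤ ε / 8 := by
    rw [hX, ← hsplit]
    rw [abs_lt] at hosc
    rw [abs_le] at hsmall ⊢
    constructor <;> linarith
  rw [abs_le] at d1 d2 ⊢
  constructor <;> linarith

lemma attain (hβ : ValidBeta β) (hΦ : IsParisiFamily β Φ) (hB : IsStdBM P B)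
    (h𝓕 : ∀ r : ℝ, (𝓕 r : MeasurableSpace Ω)
      = ⨆ v ∈ Icc (0 : ℝ) r, MeasurableSpace.comap (fun ω => B (xiD β v) ω) inferInstance)
    (hμ : MemM μ) (hs : 0 ≤ s) (hst : s < t) (ht : t ≤ 1) (x : ℝ) :
    ∃ u : ℝ → Ω → ℝ, InD 𝓕 s t u ∧
      Φ μ s x ≤ Ffn P β μ (Φ μ) (fun r => B (xiD β r)) s t u x := by
  set un : ℕ → ℝ → Ω → ℝ := fun n => pcu s t n (fbU β B Φ μ s t x n) with hun
  set u : ℝ → Ω → ℝ := fun r ω => max (-1) (min 1 (limsup (fun n => un n r ω) atTop)) with hu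
  have hch := fun n => fb_chain hβ hΦ hB h𝓕 hμ hs hst ht n (x := x)
  have h1 : ∀ n r ω, |un n r ω| ≤ 1 := fun n r ω => pcu_abs hst (fbU_abs hΦ hμ hs hst ht) r ω
  have hm : ∀ n, Measurable (Function.uncurry (un n)) := fun n => pcu_meas fun k => fbU_meas hB.1 k
  have hInD : InD 𝓕 s t u := by
    constructor
    · intro i
      have hp : ∀ n, @Measurable _ _ (@Prod.instMeasurableSpace (Iic i) Ω _ (𝓕 i)) _
          (fun p : Iic i × Ω => un n p.1 p.2) := fun n => pcu_prog hst (fun k hk =>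
            (hch n).hU k (by omega) ((hch n).meas_int k (by omega)).1) i
      letI : MeasurableSpace Ω := 𝓕 i
      have h2 : Measurable fun p : Iic i × Ω => u p.1 p.2 :=
        measurable_const.max (measurable_const.min (Measurable.limsup hp))
      exact h2.stronglyMeasurable
    · intro r _ ω
      rw [abs_le]
      exact ⟨le_max_left _ _, max_le (by norm_num) (min_le_left _ _)⟩
  refine ⟨u, hInD, ?_⟩
  have hne : ∀ᵐ r : ℝ, r ≠ t := by
    have := (countable_singleton t).ae_notMem volume
    filter_upwards [this] with r hr; exact hr
  have hF := F_tendsto hβ hΦ hB hμ hs hst ht hm h1 (u := u) (x := x) (by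
    filter_upwards [hB.2.2.1] with ω hω
    filter_upwards [hne] with r hrt hr
    have hr' : r ∈ Ico s t := ⟨hr.1.le, lt_of_le_of_ne hr.2 hrt⟩
    have hc := path_cauchy hβ hs hst ht hμ (un := fun n r => un n r ω)
      (fun n => (hm n).comp (measurable_id.prodMk measurable_const)) (fun n r => h1 n r ω)
      (f := fun r => deriv (Φ μ r)) (fun r hr y z =>
        (phi_nice hμ hΦ ⟨hs.trans hr.1, hr.2.le.trans ht⟩).deriv_lip y z)
      (w := fun r => x + (B (xiD β r) ω - B (xiD β s) ω))
      (fun ε hε => fb_close hβ hΦ hB h𝓕 hμ hs hst ht hω hε) hr'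
    obtain ⟨l, hl⟩ := cauchySeq_tendsto_of_complete hc
    have hlu : u r ω = l := by
      have a1 : l ≤ 1 := le_of_tendsto' hl fun n => (abs_le.1 (h1 n r ω)).2
      have a2 : -1 ≤ l := ge_of_tendsto' hl fun n => (abs_le.1 (h1 n r ω)).1
      simp only [hu]
      rw [hl.limsup_eq, min_eq_right a1, max_eq_right a2]
    rw [hlu]
    exact hl)
  obtain ⟨L, hL1, hL⟩ := zeta_bdd hβ
  obtain ⟨C, hC0, hC⟩ := Nice.lower
  have hG : Tendsto (fun n => Φ (nuN μ s t n) s x - C * ((t - s) * L ^ 2 * stp s t n)) atTop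
      (𝓝 (Φ μ s x - C * ((t - s) * L ^ 2 * 0))) :=
    (phi_tendsto hst hμ hΦ ⟨hs, hst.le.trans ht⟩ x).sub
      (((stp_tendsto s t).const_mul _).const_mul _)
  rw [mul_zero, mul_zero, sub_zero] at hG
  have hl1 : Tendsto (fun n => L * stp s t n) atTop (𝓝 0) := by
    simpa using (stp_tendsto s t).const_mul L
  refine le_of_tendsto_of_tendsto hG hF ?_
  filter_upwards [hl1.eventually (gt_mem_nhds (show (0 : ℝ) < 1 by positivity))] with n hn
  exact chain_lower hβ hμ hs hst ht hC0 hC hL hn.le (hch n) (fun k _ ω => rfl)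
end

end

/-- **Variational representation (Theorem 3(i)).** For `μ ∈ 𝓜`, `0 ≤ s < t ≤ 1`
and `x ∈ ℝ`, `Φ_μ(s,x) = max{F^{s,t}(u,x) : u ∈ 𝓓[s,t]}`: the supremum is
attained and equals `Φ_μ(s,x)`. Here `W r = B (ξ' r)` and `𝓕` is the filtration
generated by `W`. -/
theorem stmt6 {Ω : Type*} [mΩ : MeasurableSpace Ω] (P : Measure Ω) [IsProbabilityMeasure P]
    (β : ℕ → ℝ) (hβ : ValidBeta β)
    (Φ : Measure ℝ → ℝ → ℝ → ℝ) (hΦ : IsParisiFamily β Φ)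
    (B : ℝ → Ω → ℝ) (hB : IsStdBM P B)
    (𝓕 : Filtration ℝ mΩ)
    (h𝓕 : ∀ r : ℝ, (𝓕 r : MeasurableSpace Ω)
      = ⨆ v ∈ Icc (0 : ℝ) r, MeasurableSpace.comap (fun ω => B (xiD β v) ω) inferInstance)
    (μ : Measure ℝ) (hμ : MemM μ)
    (s t : ℝ) (hs : 0 ≤ s) (hst : s < t) (ht : t ≤ 1) (x : ℝ) :
    (∀ u : ℝ → Ω → ℝ, InD 𝓕 s t u →
        Ffn P β μ (Φ μ) (fun r => B (xiD β r)) s t u x ≤ Φ μ s x) ∧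
    ∃ u : ℝ → Ω → ℝ, InD 𝓕 s t u ∧
        Ffn P β μ (Φ μ) (fun r => B (xiD β r)) s t u x = Φ μ s x := by
  refine ⟨fun u hu => upper_bound hβ hΦ hB h𝓕 hμ hs hst ht hu, ?_⟩
  obtain ⟨u, hu, h⟩ := attain hβ hΦ hB h𝓕 hμ hs hst ht x
  exact ⟨u, hu, le_antisymm (upper_bound hβ hΦ hB h𝓕 hμ hs hst ht hu) h⟩

end
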